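/- For every ε > 0 with ε ≤ 1/2, there exist a positive integer q₁, a primitive quadratic Dirichlet character χ₁ modulo q₁, a real number β with 1 − ε < β < 1, and a constant C(ε) > 0 such that for every positive integer q₂, every primitive quadratic Dirichlet character χ₂ modulo q₂, and every real x ≥ 1: 1 ≤ C(ε) · ( x^{1−β} · λ + x^{−β} · q₂^{1+ε} ), where λ = L(1, χ₁) · L(1, χ₂) · L(1, χ₁χ₂) is the residue of ζ(s)L(s, χ₁)L(s, χ₂)L(s, χ₁χ₂) at s = 1. -/

import Mathlib

open DirichletCharacter

open HurwitzZeta Real MeasureTheory in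
theorem exp_neg_pi_bounds : rexp (-π) ≤ 1 / 20 ∧ 1 / 25 ≤ rexp (-π) := by
  have h3 : rexp 3 = rexp 1 ^ 3 := by rw [← Real.exp_nat_mul]; norm_num
  have l1 := Real.exp_one_gt_d9
  have l2 := Real.exp_one_lt_d9
  have hp := Real.pi_gt_three
  have hp2 := Real.pi_lt_d2
  rw [Real.exp_neg, ← one_div]
  constructor
  · apply one_div_le_one_div_of_le (by norm_num)
    calc (20 : ℝ) ≤ 2.718 ^ 3 := by norm_num
      _ ≤ rexp 1 ^ 3 := by gcongr; linarith
      _ = rexp 3 := h3.symm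
      _ ≤ rexp π := Real.exp_le_exp.mpr hp.le
  · apply one_div_le_one_div_of_le (by positivity)
    have h15 : rexp 0.15 ≤ 1.18 := by
      have := Real.add_one_le_exp (-0.15 : ℝ)
      have h2 : rexp 0.15 * rexp (-0.15) = 1 := by rw [← Real.exp_add]; norm_num
      nlinarith [Real.exp_pos 0.15]
    calc rexp π ≤ rexp (3 + 0.15) := Real.exp_le_exp.mpr (by linarith)
      _ = rexp 1 ^ 3 * rexp 0.15 := by rw [Real.exp_add, h3]
      _ ≤ 2.7183 ^ 3 * 1.18 := by gcongr; linarith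
      _ ≤ 25 := by norm_num

open HurwitzZeta Real in
theorem evenKernel_nonneg (a : UnitAddCircle) (t : ℝ) : 0 ≤ evenKernel a t := by
  rcases le_or_gt t 0 with ht | ht
  · rw [evenKernel_undef a ht]
  · induction a using QuotientAddGroup.induction_on with
    | H b => exact (hasSum_int_evenKernel b ht).nonneg fun n => (Real.exp_pos _).le

open HurwitzZeta Real in
theorem exp_le_evenKernel (a : UnitAddCircle) {t : ℝ} (ht : 0 < t) :
    rexp (-π * t / 4) ≤ evenKernel a t := by
  induction a using QuotientAddGroup.induction_on with
  | H b =>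
    have hs := hasSum_int_evenKernel b ht
    refine le_trans ?_ (le_hasSum hs (-round b) fun n _ => (Real.exp_pos _).le)
    apply Real.exp_le_exp.mpr
    have h1 : (((-round b : ℤ) : ℝ) + b) ^ 2 ≤ (1 / 2) ^ 2 := by
      have := abs_sub_round b
      apply sq_le_sq'
      · push_cast; linarith [(abs_le.mp this).1]
      · push_cast; linarith [(abs_le.mp this).2]
    have := mul_le_mul_of_nonneg_left h1 (mul_pos Real.pi_pos ht).le
    nlinarith

open HurwitzZeta Real in
theorem neg_le_cosKernel_sub_one (a : UnitAddCircle) {u : ℝ} (hu : 1 ≤ u) :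
    -(2 / 19) ≤ u * (cosKernel a u - 1) := by
  have hu0 : 0 < u := by linarith
  obtain ⟨he1, he2⟩ := exp_neg_pi_bounds
  induction a using QuotientAddGroup.induction_on with
  | H b =>
    have hs := hasSum_nat_cosKernel₀ b hu0
    have hg : HasSum (fun n : ℕ => 2 * rexp (-π * u) * rexp (-π) ^ n)
        (2 * rexp (-π * u) * (1 - rexp (-π))⁻¹) :=
      (hasSum_geometric_of_lt_one (Real.exp_pos _).le (by linarith)).mul_left _
    have hb : ‖cosKernel b u - 1‖ ≤ 2 * rexp (-π * u) * (1 - rexp (-π))⁻¹ := by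
      rw [← hs.tsum_eq]
      refine tsum_of_norm_bounded hg fun n => ?_
      rw [norm_mul, norm_mul, Real.norm_of_nonneg (Real.exp_pos _).le, ← Real.exp_nat_mul,
        mul_assoc 2 (rexp _), ← Real.exp_add]
      have h1 : ‖Real.cos (2 * π * b * (n + 1))‖ ≤ 1 := Real.abs_cos_le_one _
      have h2 : rexp (-π * (n + 1) ^ 2 * u) ≤ rexp (-π * u + n * -π) := by
        apply Real.exp_le_exp.mpr
        have : u + n ≤ (n + 1 : ℝ) ^ 2 * u := by
          have hn : (0 : ℝ) ≤ n := n.cast_nonneg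
          nlinarith [mul_nonneg hn hn, mul_nonneg hn (sub_nonneg.mpr hu),
            mul_nonneg (mul_nonneg hn hn) hu0.le]
        nlinarith [mul_le_mul_of_nonneg_left this Real.pi_pos.le]
      calc ‖(2 : ℝ)‖ * ‖Real.cos (2 * π * b * (n + 1))‖ * rexp (-π * (n + 1) ^ 2 * u)
          ≤ 2 * 1 * rexp (-π * u + n * -π) := by
            gcongr; norm_num
        _ = _ := by ring
    have hu2 : u * rexp (-π * u) ≤ 1 / 20 := by
      have h1 : u ≤ rexp (π * (u - 1)) := by
        have := Real.add_one_le_exp (π * (u - 1))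
        nlinarith [Real.pi_gt_three]
      calc u * rexp (-π * u) ≤ rexp (π * (u - 1)) * rexp (-π * u) := by gcongr
        _ = rexp (-π) := by rw [← Real.exp_add]; congr 1; ring
        _ ≤ _ := he1
    have hinv : (1 - rexp (-π))⁻¹ ≤ 20 / 19 := by
      rw [inv_le_comm₀ (by linarith) (by norm_num)]; norm_num; linarith
    have hle := (abs_le.mp hb).1
    have hinv0 : 0 ≤ (1 - rexp (-π))⁻¹ := inv_nonneg.mpr (by linarith)
    have h3 : u * (2 * rexp (-π * u) * (1 - rexp (-π))⁻¹) ≤ 2 / 19 := by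
      calc u * (2 * rexp (-π * u) * (1 - rexp (-π))⁻¹)
          = 2 * (u * rexp (-π * u)) * (1 - rexp (-π))⁻¹ := by ring
        _ ≤ 2 * (1 / 20) * (20 / 19) := by gcongr
        _ = _ := by norm_num
    nlinarith [mul_le_mul_of_nonneg_left hle hu0.le]

open HurwitzZeta Real MeasureTheory in
theorem exists_pos_hurwitzZetaEven_one_eq {a : UnitAddCircle} (ha : a ≠ 0) :
    ∃ r : ℝ, 0 < r ∧ hurwitzZetaEven a 1 = (r : ℂ) := by
  set I : ℝ → ℝ := fun t => t ^ (-(1 / 2) : ℝ) *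
    ((Set.Ioi 1).indicator (evenKernel a) t +
      (Set.Ioo 0 1).indicator (fun x => evenKernel a x - x ^ (-(1 / 2) : ℝ)) t) with hI
  have hfun : Set.EqOn (fun t : ℝ => (t : ℂ) ^ ((1 / 2 : ℂ) - 1) • (hurwitzEvenFEPair a).f_modif t)
      (fun t => ((I t : ℝ) : ℂ)) (Set.Ioi 0) := by
    intro t ht
    have ht' : (0 : ℝ) ≤ t := (Set.mem_Ioi.mp ht).le
    have e1 : (t : ℂ) ^ ((1 / 2 : ℂ) - 1) = ((t ^ (-(1 / 2) : ℝ) : ℝ) : ℂ) := by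
      rw [Complex.ofReal_cpow ht']; congr 1; push_cast; ring
    simp only [hI, WeakFEPair.f_modif, hurwitzEvenFEPair, e1, Pi.add_apply, smul_eq_mul]
    push_cast
    congr 1
    by_cases h1 : t ∈ Set.Ioi (1 : ℝ) <;> by_cases h2 : t ∈ Set.Ioo (0 : ℝ) 1 <;>
      simp [h1, h2, ha, Set.indicator]
  have hint : IntegrableOn I (Set.Ioi 0) := by
    have h := ((hurwitzEvenFEPair a).isStrongFEPair_toStrongFEPair.hasMellin (1 / 2)).1
    have h2 : IntegrableOn (fun t => ((I t : ℝ) : ℂ)) (Set.Ioi 0) :=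
      (integrableOn_congr_fun hfun measurableSet_Ioi).mp h
    have h3 := h2.re
    exact h3
  have hval : hurwitzZetaEven a 1 = (((∫ t in Set.Ioi 0, I t) / 2 : ℝ) : ℂ) := by
    rw [hurwitzZetaEven_def_of_ne_or_ne (Or.inl ha), Complex.Gammaℝ_one, div_one,
      completedHurwitzZetaEven_eq, completedHurwitzZetaEven₀, WeakFEPair.Λ₀, mellin,
      setIntegral_congr_fun measurableSet_Ioi hfun, integral_complex_ofReal]
    simp [ha]
  refine ⟨_, ?_, hval⟩
  set g : ℝ → ℝ := fun t => (Set.Ioc 1 2).indicator (fun _ => (1 / 8 : ℝ)) t +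
    (Set.Ioc 0 1).indicator (fun _ => (-(2 / 19) : ℝ)) t with hg
  have hgint1 : Integrable ((Set.Ioc (1 : ℝ) 2).indicator (fun _ => (1 / 8 : ℝ)))
      (volume.restrict (Set.Ioi 0)) :=
    (integrable_indicator_iff measurableSet_Ioc).mpr (integrableOn_const (by
      rw [Measure.restrict_apply measurableSet_Ioc]
      exact ne_top_of_le_ne_top (by simp) (measure_mono Set.inter_subset_left)))
  have hgint2 : Integrable ((Set.Ioc (0 : ℝ) 1).indicator (fun _ => (-(2 / 19) : ℝ)))
      (volume.restrict (Set.Ioi 0)) :=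
    (integrable_indicator_iff measurableSet_Ioc).mpr (integrableOn_const (by
      rw [Measure.restrict_apply measurableSet_Ioc]
      exact ne_top_of_le_ne_top (by simp) (measure_mono Set.inter_subset_left)))
  have hgI : ∀ t ∈ Set.Ioi (0 : ℝ), g t ≤ I t := by
    intro t ht
    have ht : 0 < t := ht
    have hp : 0 ≤ t ^ (-(1 / 2) : ℝ) := Real.rpow_nonneg ht.le _
    rcases lt_trichotomy t 1 with h | h | h
    · have hu : 1 ≤ 1 / t := by rw [le_div_iff₀ ht]; linarith
      have hc := neg_le_cosKernel_sub_one a hu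
      have : I t = 1 / t * (cosKernel a (1 / t) - 1) := by
        have e : t ^ (-(1 / 2) : ℝ) * t ^ (-(1 / 2) : ℝ) = 1 / t := by
          rw [← Real.rpow_add ht]; norm_num [Real.rpow_neg_one]
        simp only [hI]
        rw [Set.indicator_of_notMem (by simp; linarith), Set.indicator_of_mem (Set.mem_Ioo.mpr ⟨ht, h⟩),
          evenKernel_functional_equation, one_div (t ^ _), ← Real.rpow_neg ht.le]
        linear_combination (cosKernel a (1 / t) - 1) * e
      rw [this, hg]
      simp only
      rw [Set.indicator_of_notMem (by simp; intros; linarith), Set.indicator_of_mem (Set.mem_Ioc.mpr ⟨ht, h.le⟩)]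
      linarith
    · subst h
      simp [hg, hI]
      norm_num
    · have hk := evenKernel_nonneg a t
      have hI' : I t = t ^ (-(1 / 2) : ℝ) * evenKernel a t := by
        simp only [hI]
        rw [Set.indicator_of_mem (by simpa using h),
          Set.indicator_of_notMem (by simp; intros; linarith), add_zero]
      rw [hI', hg]
      simp only
      rw [Set.indicator_of_notMem (s := Set.Ioc 0 1) (by simp; intros; linarith), add_zero]
      by_cases h2 : t ≤ 2
      · rw [Set.indicator_of_mem (Set.mem_Ioc.mpr ⟨h, h2⟩)]
        have hk2 := exp_le_evenKernel a ht
        have e1 : (1 / 5 : ℝ) ≤ rexp (-π * t / 4) := by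
          have h5 : (1 / 5 : ℝ) ≤ rexp (-π / 2) := by
            have : rexp (-π) = rexp (-π / 2) ^ 2 := by
              rw [← Real.exp_nat_mul]; congr 1; push_cast; ring
            have h25 := exp_neg_pi_bounds.2
            rw [this] at h25
            nlinarith [Real.exp_pos (-π / 2)]
          refine h5.trans (Real.exp_le_exp.mpr ?_)
          nlinarith [Real.pi_pos]
        have e2 : (5 / 8 : ℝ) ≤ t ^ (-(1 / 2) : ℝ) := by
          rw [Real.rpow_neg ht.le, ← Real.sqrt_eq_rpow,
            le_inv_comm₀ (by norm_num) (Real.sqrt_pos.mpr ht)]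
          rw [Real.sqrt_le_left (by norm_num)]
          norm_num; linarith
        calc (1 / 8 : ℝ) = 5 / 8 * (1 / 5) := by norm_num
          _ ≤ _ := mul_le_mul e2 (e1.trans hk2) (by norm_num) hp
      · rw [Set.indicator_of_notMem (by simp; intros; linarith)]
        positivity
  have h := setIntegral_mono_on (hgint1.add hgint2) hint measurableSet_Ioi hgI
  have hgv : ∫ t in Set.Ioi 0, ((Set.Ioc (1 : ℝ) 2).indicator (fun _ => (1 / 8 : ℝ)) +
      (Set.Ioc (0 : ℝ) 1).indicator (fun _ => (-(2 / 19) : ℝ))) t = 1 / 8 - 2 / 19 := by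
    rw [integral_add' hgint1 hgint2, setIntegral_indicator measurableSet_Ioc,
      setIntegral_indicator measurableSet_Ioc,
      Set.inter_eq_right.mpr (fun x hx => by simp at hx ⊢; linarith),
      Set.inter_eq_right.mpr (fun x hx => by simp at hx ⊢; linarith)]
    norm_num
  rw [hgv] at h
  linarith

/-- The value at `1` of the principal `L`-function (a pole, where Mathlib assigns the constant term
of the completed function) is a positive real. -/
theorem exists_pos_LFunction_one_eq {N : ℕ} [NeZero N] (hN : N ≠ 1) :
    ∃ r : ℝ, 0 < r ∧ LFunction (1 : DirichletCharacter ℂ N) 1 = (r : ℂ) := by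
  have hN1 : 1 < N := lt_of_le_of_ne NeZero.one_le hN.symm
  have : Fact (1 < N) := ⟨hN1⟩
  have hev : Function.Even (fun j : ZMod N => (1 : DirichletCharacter ℂ N) j) := by
    intro j
    exact (show (1 : DirichletCharacter ℂ N).Even from by
      simp [DirichletCharacter.Even, MulChar.one_apply]).to_fun j
  have hterm : ∀ j : ZMod N, ∃ r : ℝ, 0 ≤ r ∧ (j = 1 → 0 < r) ∧
      (1 : DirichletCharacter ℂ N) j * HurwitzZeta.hurwitzZetaEven (ZMod.toAddCircle j) 1
        = (r : ℂ) := by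
    intro j
    by_cases hj : IsUnit j
    · have : ZMod.toAddCircle j ≠ 0 := by
        rw [Ne, ZMod.toAddCircle_eq_zero]; exact hj.ne_zero
      obtain ⟨r, hr, h⟩ := exists_pos_hurwitzZetaEven_one_eq this
      exact ⟨r, hr.le, fun _ => hr, by rw [h, MulChar.one_apply hj, one_mul]⟩
    · refine ⟨0, le_rfl, ?_, by simp [MulChar.map_nonunit _ hj]⟩
      rintro rfl; exact absurd isUnit_one hj
  choose r hr0 hr1 hr using hterm
  refine ⟨(N : ℝ)⁻¹ * ∑ j, r j, ?_, ?_⟩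
  · have : 0 < ∑ j, r j :=
      Finset.sum_pos' (fun j _ => hr0 j) ⟨1, Finset.mem_univ _, hr1 1 rfl⟩
    have := NeZero.pos N
    positivity
  · rw [DirichletCharacter.LFunction, ZMod.LFunction_def_even hev, Complex.cpow_neg_one]
    simp only [hr]
    push_cast; rfl

theorem inv_eq_self_of_sq_eq_one {q : ℕ} {χ : DirichletCharacter ℂ q} (hχ : χ ^ 2 = 1) :
    χ⁻¹ = χ :=
  inv_eq_of_mul_eq_one_left (by rw [← sq, hχ])

theorem apply_mul_gaussSum_of_sq_eq_one {q : ℕ} [NeZero q] {χ : DirichletCharacter ℂ q}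
    (hprim : χ.IsPrimitive) (hχ : χ ^ 2 = 1) (a : ZMod q) :
    χ a * gaussSum χ ZMod.stdAddChar = ∑ b, χ b * ZMod.stdAddChar (a * b) := by
  have h := gaussSum_mulShift_of_isPrimitive ZMod.stdAddChar hprim a
  rw [inv_eq_self_of_sq_eq_one hχ] at h
  rw [← h]; simp only [gaussSum, AddChar.mulShift_apply]

theorem norm_gaussSum_sq_of_sq_eq_one {q : ℕ} [NeZero q] {χ : DirichletCharacter ℂ q}
    (hprim : χ.IsPrimitive) (hχ : χ ^ 2 = 1) : ‖gaussSum χ ZMod.stdAddChar‖ ^ 2 = q := by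
  set τ := gaussSum χ ZMod.stdAddChar with hτ
  have h1 : ∑ n, χ n * τ * ZMod.stdAddChar (-n) = q := by
    simp only [hτ, apply_mul_gaussSum_of_sq_eq_one hprim hχ, Finset.sum_mul]
    rw [Finset.sum_comm]
    have : ∀ b : ZMod q, ∑ n, χ b * ZMod.stdAddChar (n * b) * ZMod.stdAddChar (-n)
        = if b = 1 then (q : ℂ) * χ b else 0 := by
      intro b
      have h := AddChar.sum_mulShift (b - 1) (ZMod.isPrimitive_stdAddChar q)
      rw [ZMod.card] at h
      have h2 : ∀ n : ZMod q, χ b * ZMod.stdAddChar (n * b) * ZMod.stdAddChar (-n)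
          = χ b * ZMod.stdAddChar (n * (b - 1)) := by
        intro n
        rw [mul_assoc, ← AddChar.map_add_eq_mul]; ring_nf
      simp only [h2, ← Finset.mul_sum, h, sub_eq_zero]
      split_ifs <;> simp [mul_comm]
    simp only [this]
    simp
  have h2 : ∑ n, χ n * τ * ZMod.stdAddChar (-n) = τ * (χ (-1) * τ) := by
    rw [hτ, apply_mul_gaussSum_of_sq_eq_one hprim hχ (-1), Finset.mul_sum]
    exact Finset.sum_congr rfl fun n _ => by rw [neg_one_mul]; ring
  have h3 : ‖χ (-1)‖ = 1 := by
    have : χ (-1) * χ (-1) = 1 := by rw [← map_mul]; simp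
    have h4 := congrArg norm this
    rw [norm_mul, norm_one] at h4
    nlinarith [norm_nonneg (χ (-1))]
  have h4 := congrArg norm (h2.symm.trans h1)
  rw [norm_mul, norm_mul, h3, one_mul, Complex.norm_natCast] at h4
  rw [sq, h4]

theorem sum_zmod_val {R : Type*} [AddCommMonoid R] {q : ℕ} [NeZero q] (f : ℕ → R) :
    ∑ c : ZMod q, f c.val = ∑ v ∈ Finset.range q, f v :=
  Finset.sum_nbij' ZMod.val (fun v => (v : ZMod q)) (fun c _ => by simp [ZMod.val_lt])
    (fun v _ => Finset.mem_univ _) (fun c _ => by simp)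
    (fun v hv => ZMod.val_cast_of_lt (by simpa using hv)) (fun c _ => rfl)

theorem norm_geom_sum_stdAddChar_le {q : ℕ} [NeZero q] {c : ZMod q} (hc : c ≠ 0) (K : ℕ) :
    ‖∑ k ∈ Finset.range K, (ZMod.stdAddChar c : ℂ) ^ k‖ ≤
      q / 2 * ((c.val : ℝ)⁻¹ + ((q : ℝ) - c.val)⁻¹) := by
  have hq : (0 : ℝ) < q := Nat.cast_pos.mpr (NeZero.pos q)
  have hv : (0 : ℝ) < c.val := Nat.cast_pos.mpr (ZMod.val_pos.mpr hc)
  have hvq : (0 : ℝ) < q - c.val := by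
    have : (c.val : ℝ) < q := Nat.cast_lt.mpr (ZMod.val_lt c)
    linarith
  set v : ℝ := (c.val : ℝ) with hvdef
  have hnorm : ‖(ZMod.stdAddChar c : ℂ) - 1‖ = 2 * Real.sin (Real.pi * v / q) := by
    have e1 : (ZMod.stdAddChar c : ℂ) = Complex.exp (Complex.I * ((2 * Real.pi * v / q : ℝ) : ℂ)) := by
      conv_lhs => rw [← ZMod.natCast_zmod_val c]
      rw [ZMod.stdAddChar_apply, ZMod.toCircle_natCast]
      congr 1; rw [hvdef]; push_cast; ring
    rw [e1, Complex.norm_exp_I_mul_ofReal_sub_one, Real.norm_of_nonneg]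
    · congr 2; ring
    · apply mul_nonneg (by norm_num)
      apply Real.sin_nonneg_of_nonneg_of_le_pi (by positivity)
      rw [div_div, div_le_iff₀ (by positivity)]
      nlinarith [Real.pi_pos]
  have hsin : ∃ u, 0 < u ∧ (u = v ∨ u = q - v) ∧ 2 * u / q ≤ Real.sin (Real.pi * v / q) := by
    rcases le_total v (q / 2) with h | h
    · refine ⟨v, hv, Or.inl rfl, ?_⟩
      have := Real.mul_le_sin (x := Real.pi * v / q) (by positivity) (by
        rw [div_le_iff₀ hq]; nlinarith [Real.pi_pos])
      calc 2 * v / q = 2 / Real.pi * (Real.pi * v / q) := by field_simp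
        _ ≤ _ := this
    · refine ⟨q - v, hvq, Or.inr rfl, ?_⟩
      have := Real.mul_le_sin (x := Real.pi * (q - v) / q) (by positivity) (by
        rw [div_le_iff₀ hq]; nlinarith [Real.pi_pos])
      calc 2 * (q - v) / q = 2 / Real.pi * (Real.pi * (q - v) / q) := by field_simp
        _ ≤ _ := this
        _ = _ := by rw [← Real.sin_pi_sub]; congr 1; field_simp; ring
  obtain ⟨u, hu, hu2, hus⟩ := hsin
  have hpos : 0 < 4 * u / q := by positivity
  have hlow : 4 * u / q ≤ ‖(ZMod.stdAddChar c : ℂ) - 1‖ := by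
    rw [hnorm]; calc 4 * u / q = 2 * (2 * u / q) := by ring
      _ ≤ _ := by gcongr
  have hne : (ZMod.stdAddChar c : ℂ) ≠ 1 := by
    intro h; rw [h, sub_self, norm_zero] at hlow; linarith
  rw [geom_sum_eq hne, norm_div]
  have htop : ‖(ZMod.stdAddChar c : ℂ) ^ K - 1‖ ≤ 2 := by
    refine (norm_sub_le _ _).trans ?_
    rw [norm_pow, AddChar.norm_apply]; norm_num
  calc ‖(ZMod.stdAddChar c : ℂ) ^ K - 1‖ / ‖(ZMod.stdAddChar c : ℂ) - 1‖
      ≤ 2 / (4 * u / q) := by gcongr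
    _ = q / 2 * u⁻¹ := by field_simp; norm_num
    _ ≤ _ := by
      gcongr
      have := inv_pos.mpr hv
      have := inv_pos.mpr hvq
      rcases hu2 with rfl | rfl <;> linarith

theorem sum_inv_val_add_le {q : ℕ} [NeZero q] :
    ∑ c : ZMod q, (q / 2 * ((c.val : ℝ)⁻¹ + ((q : ℝ) - c.val)⁻¹)) ≤ q * (1 + Real.log q) := by
  have hlog := harmonic_le_one_add_log q
  have hH : ((harmonic q : ℚ) : ℝ) = ∑ i ∈ Finset.range q, ((i : ℝ) + 1)⁻¹ := by
    simp [harmonic]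
  rw [sum_zmod_val (fun v => q / 2 * ((v : ℝ)⁻¹ + ((q : ℝ) - v)⁻¹)), ← Finset.mul_sum,
    Finset.sum_add_distrib]
  have h1 : ∑ v ∈ Finset.range q, ((q : ℝ) - v)⁻¹ = harmonic q := by
    rw [hH, ← Finset.sum_range_reflect]
    refine Finset.sum_congr rfl fun v hv => ?_
    have : v + 1 ≤ q := by simpa using hv
    rw [show q - 1 - v = q - (v + 1) by omega, Nat.cast_sub this]
    push_cast; congr 1; ring
  have h2 : ∑ v ∈ Finset.range q, (v : ℝ)⁻¹ ≤ harmonic q := by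
    obtain ⟨n, rfl⟩ := Nat.exists_eq_succ_of_ne_zero (NeZero.ne q)
    rw [Finset.sum_range_succ', hH, Finset.sum_range_succ]
    push_cast
    simp only [inv_zero, add_zero]
    have : (0 : ℝ) ≤ ((n : ℝ) + 1)⁻¹ := by positivity
    linarith
  rw [h1]
  have hq : (0 : ℝ) ≤ q := Nat.cast_nonneg q
  nlinarith

theorem card_filter_nsmul_eq_le {q : ℕ} [NeZero q] {m : ℕ} (hm : 0 < m) (c : ZMod q) :
    (Finset.univ.filter fun b : ZMod q => (m : ZMod q) * b = c).card ≤ m := by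
  rcases (Finset.univ.filter fun b : ZMod q => (m : ZMod q) * b = c).eq_empty_or_nonempty with h | h
  · rw [h]; simp
  · obtain ⟨b₀, hb₀⟩ := h
    refine le_trans ?_ (IsAddCyclic.card_nsmul_eq_zero_le (α := ZMod q) hm)
    refine Finset.card_le_card_of_injOn (fun b => b - b₀) ?_ (fun x _ y _ h => by simpa using h)
    intro b hb
    simp only [Finset.coe_filter, Finset.mem_univ, true_and, Set.mem_ofPred_eq,
      Finset.mem_filter] at hb hb₀ ⊢
    rw [nsmul_eq_mul, mul_sub, hb, hb₀, sub_self]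

/-- The Pólya–Vinogradov inequality for a primitive quadratic character along an arithmetic
progression of common difference not divisible by the modulus. -/
theorem norm_sum_arithProg_le {q : ℕ} [NeZero q] {χ : DirichletCharacter ℂ q}
    (hprim : χ.IsPrimitive) (hχ : χ ^ 2 = 1) {m : ℕ} (hm : ¬ q ∣ m) (a K : ℕ) :
    ‖∑ k ∈ Finset.range K, χ ((a + m * k : ℕ) : ZMod q)‖ ≤
      m * (Real.sqrt q * (1 + Real.log q)) := by
  have hq : (0 : ℝ) < q := Nat.cast_pos.mpr (NeZero.pos q)
  have hm0 : 0 < m := Nat.pos_of_ne_zero fun h => hm (h ▸ dvd_zero q)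
  set τ := gaussSum χ ZMod.stdAddChar with hτ
  have hτn : ‖τ‖ = Real.sqrt q := by
    rw [← norm_gaussSum_sq_of_sq_eq_one hprim hχ, Real.sqrt_sq (norm_nonneg _)]
  set g : ZMod q → ℝ := fun c => q / 2 * ((c.val : ℝ)⁻¹ + ((q : ℝ) - c.val)⁻¹) with hg
  have hg0 : ∀ c, 0 ≤ g c := fun c => by
    have : (c.val : ℝ) < q := Nat.cast_lt.mpr (ZMod.val_lt c)
    have : 0 ≤ ((q : ℝ) - c.val)⁻¹ := inv_nonneg.mpr (by linarith)
    simp only [hg]; positivity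
  have hexp : (∑ k ∈ Finset.range K, χ ((a + m * k : ℕ) : ZMod q)) * τ =
      ∑ b, χ b * ZMod.stdAddChar ((a : ZMod q) * b) *
        ∑ k ∈ Finset.range K, (ZMod.stdAddChar ((m : ZMod q) * b) : ℂ) ^ k := by
    simp only [Finset.sum_mul, hτ, apply_mul_gaussSum_of_sq_eq_one hprim hχ, Finset.mul_sum]
    rw [Finset.sum_comm]
    refine Finset.sum_congr rfl fun b _ => Finset.sum_congr rfl fun k _ => ?_
    rw [← AddChar.map_nsmul_eq_pow, mul_assoc, ← AddChar.map_add_eq_mul]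
    congr 2
    rw [nsmul_eq_mul]; push_cast; ring
  have hb : ∀ b : ZMod q, ‖χ b * ZMod.stdAddChar ((a : ZMod q) * b) *
      ∑ k ∈ Finset.range K, (ZMod.stdAddChar ((m : ZMod q) * b) : ℂ) ^ k‖ ≤ g (m * b) := by
    intro b
    by_cases hu : IsUnit b
    · have hc : (m : ZMod q) * b ≠ 0 := by
        rw [Ne, hu.mul_left_eq_zero, ZMod.natCast_eq_zero_iff]; exact hm
      rw [norm_mul, norm_mul, AddChar.norm_apply, mul_one]
      calc _ ≤ 1 * g (m * b) := by
            gcongr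
            · exact DirichletCharacter.norm_le_one χ b
            · exact norm_geom_sum_stdAddChar_le hc K
        _ = _ := one_mul _
    · rw [MulChar.map_nonunit _ hu]; simpa using hg0 _
  have hsum : ∑ b : ZMod q, g (m * b) ≤ m * (q * (1 + Real.log q)) := by
    rw [Finset.sum_comp g (fun b : ZMod q => (m : ZMod q) * b)]
    calc _ ≤ ∑ c ∈ Finset.image (fun b : ZMod q => (m : ZMod q) * b) Finset.univ, m * g c := by
          refine Finset.sum_le_sum fun c _ => ?_
          rw [nsmul_eq_mul]
          gcongr
          · exact hg0 c
          · exact card_filter_nsmul_eq_le hm0 c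
      _ ≤ ∑ c, m * g c := Finset.sum_le_sum_of_subset_of_nonneg (Finset.subset_univ _)
          fun c _ _ => mul_nonneg (Nat.cast_nonneg _) (hg0 c)
      _ ≤ _ := by rw [← Finset.mul_sum]; gcongr; exact sum_inv_val_add_le
  have h := congrArg norm hexp
  rw [norm_mul, hτn] at h
  have h2 := h.le.trans ((norm_sum_le _ _).trans ((Finset.sum_le_sum fun b _ => hb b).trans hsum))
  have hs : 0 < Real.sqrt q := Real.sqrt_pos.mpr hq
  rw [← le_div_iff₀ hs] at h2
  refine h2.trans (le_of_eq ?_)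
  rw [div_eq_iff hs.ne']
  nth_rewrite 1 [← Real.mul_self_sqrt hq.le]
  ring

open Complex Filter Topology Asymptotics MeasureTheory Set in
/-- If the coefficient sums of an L-series are `O(t ^ θ)`, the analytic continuation of the
L-series to `θ < re s` is approximated by its partial sums. -/
theorem norm_continuation_sub_sum_le {f : ℕ → ℂ} {G : ℂ → ℂ} {θ B : ℝ} {M : ℕ} (hθ : 0 ≤ θ)
    (hM : 1 ≤ M) (hB : ∀ n ≥ M, ‖∑ k ∈ Finset.Icc 1 n, f k‖ ≤ B * (n : ℝ) ^ θ)
    (hS : ∀ s : ℂ, 1 < s.re → LSeriesSummable f s)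
    (hG : ∀ s : ℂ, 1 < s.re → G s = LSeries f s)
    (hd : ∀ s : ℂ, θ < s.re → DifferentiableAt ℂ G s) {σ : ℝ} (hσ : θ < σ) :
    ‖G σ - ∑ n ∈ Finset.Icc 1 M, f n * (n : ℂ) ^ (-σ : ℂ)‖ ≤
      2 * B * (σ / (σ - θ)) * (M : ℝ) ^ (θ - σ) := by
  have hMpos : (0 : ℝ) < M := by exact_mod_cast hM
  have hB0 : 0 ≤ B := by
    have h := (norm_nonneg _).trans (hB M le_rfl)
    exact nonneg_of_mul_nonneg_left h (Real.rpow_pos_of_pos hMpos _)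
  set f₁ : ℕ → ℂ := fun n => if M < n then f n else 0 with hf₁
  set f₂ : ℕ → ℂ := fun n => if M < n then 0 else f n with hf₂
  have hf : f₁ + f₂ = f := by ext n; by_cases h : M < n <;> simp [hf₁, hf₂, h]
  have hsupp : ∀ s : ℂ, ∀ n ∉ Finset.Icc 1 M, LSeries.term f₂ s n = 0 := by
    intro s n hn
    rcases Nat.eq_zero_or_pos n with rfl | h0
    · simp
    · have : M < n := by simp at hn; omega
      simp [LSeries.term, hf₂, this]
  have hS₂ : ∀ s : ℂ, LSeriesSummable f₂ s := fun s => summable_of_ne_finset_zero (hsupp s)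
  have hL₂ : ∀ s : ℂ, LSeries f₂ s = ∑ n ∈ Finset.Icc 1 M, f n * (n : ℂ) ^ (-s) := by
    intro s
    rw [LSeries, tsum_eq_sum (hsupp s)]
    refine Finset.sum_congr rfl fun n hn => ?_
    obtain ⟨h1, h2⟩ := Finset.mem_Icc.mp hn
    rw [LSeries.term_of_ne_zero (by omega)]
    simp [hf₂, not_lt.mpr h2, Complex.cpow_neg, div_eq_mul_inv]
  have hS₁ : ∀ s : ℂ, 1 < s.re → LSeriesSummable f₁ s := by
    intro s hs
    have h := (hS s hs).sub (hS₂ s)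
    rwa [← hf, add_sub_cancel_right] at h
  have hsum : ∀ n ≥ M, ∑ k ∈ Finset.Icc 1 n, f₁ k =
      ∑ k ∈ Finset.Icc 1 n, f k - ∑ k ∈ Finset.Icc 1 M, f k := by
    intro n hn
    have h1 : ∑ k ∈ Finset.Icc 1 n, f₂ k = ∑ k ∈ Finset.Icc 1 M, f k := by
      rw [← Finset.sum_subset (Finset.Icc_subset_Icc_right hn)]
      · exact Finset.sum_congr rfl fun k hk => by
          simp [hf₂, not_lt.mpr (Finset.mem_Icc.mp hk).2]
      · intro k hk hk2
        have : M < k := by simp at hk hk2; omega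
        simp [hf₂, this]
    rw [← h1, ← Finset.sum_sub_distrib]
    exact Finset.sum_congr rfl fun k _ => by rw [← hf]; simp
  set T : ℝ → ℂ := fun t => ∑ k ∈ Finset.Icc 1 ⌊t⌋₊, f₁ k with hT
  have hT0 : ∀ t < (M : ℝ) + 1, T t = 0 := by
    intro t ht
    refine Finset.sum_eq_zero fun k hk => ?_
    have : ⌊t⌋₊ < M + 1 := (Nat.floor_lt' (by omega)).mpr (by exact_mod_cast ht)
    have : ¬ M < k := by have := (Finset.mem_Icc.mp hk).2; omega
    simp [hf₁, this]
  have hTB : ∀ t ≥ (M : ℝ), ‖T t‖ ≤ 2 * B * t ^ θ := by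
    intro t ht
    have hfl : M ≤ ⌊t⌋₊ := Nat.le_floor ht
    have ht0 : 0 ≤ t := hMpos.le.trans ht
    simp only [hT]
    rw [hsum _ hfl]
    calc _ ≤ B * (⌊t⌋₊ : ℝ) ^ θ + B * (M : ℝ) ^ θ :=
          (norm_sub_le _ _).trans (add_le_add (hB _ hfl) (hB _ le_rfl))
      _ ≤ B * t ^ θ + B * t ^ θ := by
          gcongr
          exact Nat.floor_le ht0
      _ = _ := by ring
  have hTloc : LocallyIntegrableOn T (Ioi 0) := by
    have h := locallyIntegrableOn_mul_sum_Icc (a := (0 : ℝ)) (g := fun _ => (1 : ℂ)) (c := f₁) (m := 1)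
      le_rfl (locallyIntegrableOn_const _)
    simp only [one_mul] at h
    exact h.mono_set Ioi_subset_Ici_self
  have hTtop : T =O[atTop] (fun t : ℝ => t ^ (-(-θ))) := by
    refine IsBigO.of_bound (2 * B) ?_
    filter_upwards [eventually_ge_atTop (M : ℝ)] with t ht
    rw [neg_neg, Real.norm_of_nonneg (Real.rpow_nonneg (hMpos.le.trans ht) _)]
    exact hTB t ht
  have hTbot : ∀ b : ℝ, T =O[𝓝[>] 0] (fun t : ℝ => t ^ (-b)) := by
    intro b
    refine IsBigO.of_bound 1 ?_
    filter_upwards [mem_nhdsWithin_of_mem_nhds (Iio_mem_nhds (show (0 : ℝ) < M + 1 by positivity))]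
      with t ht
    rw [hT0 t ht, norm_zero]; positivity
  have hdiff : ∀ s : ℂ, θ < s.re → DifferentiableAt ℂ (fun s => s * mellin T (-s)) s := by
    intro s hs
    have : DifferentiableAt ℂ (mellin T) (-s) :=
      mellin_differentiableAt_of_isBigO_rpow hTloc hTtop (by simpa using hs)
        (hTbot ((-s).re - 1)) (by linarith)
    exact differentiableAt_id.mul (this.comp s differentiableAt_id.neg)
  have hmel : ∀ s : ℂ, mellin T (-s) = ∫ t in Ioi (M : ℝ), T t * (t : ℂ) ^ (-(s + 1)) := by
    intro s
    rw [mellin]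
    rw [← setIntegral_eq_of_subset_of_forall_sdiff_eq_zero (s := Ioi (M : ℝ)) measurableSet_Ioi
      (Ioi_subset_Ioi hMpos.le)]
    · refine setIntegral_congr_fun measurableSet_Ioi fun t _ => ?_
      simp only [smul_eq_mul]
      rw [mul_comm, neg_add']
    · intro t ht
      rw [hT0 t (by simp at ht; linarith [ht.2]), zero_mul]
  have hO : (fun n : ℕ => ∑ k ∈ Finset.Icc 1 n, f₁ k) =O[atTop] fun n : ℕ => (n : ℝ) ^ θ := by
    refine IsBigO.of_bound (2 * B) ?_
    filter_upwards [eventually_ge_atTop M] with n hn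
    rw [Real.norm_of_nonneg (Real.rpow_nonneg (Nat.cast_nonneg n) _)]
    simpa [hT] using hTB n (by exact_mod_cast hn)
  have hL₁ : ∀ s : ℂ, max θ 1 < s.re → LSeries f₁ s = s * mellin T (-s) := by
    intro s hs
    rw [LSeries_eq_mul_integral f₁ hθ ((le_max_left _ _).trans_lt hs)
      (hS₁ s ((le_max_right _ _).trans_lt hs)) hO, hmel]
    congr 1
    refine setIntegral_eq_of_subset_of_forall_sdiff_eq_zero measurableSet_Ioi
      (Ioi_subset_Ioi (by exact_mod_cast hM)) fun t ht => ?_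
    change T t * _ = 0
    rw [hT0 t (by simp at ht; linarith [ht.2]), zero_mul]
  set U : Set ℂ := {s : ℂ | θ < s.re} with hU
  have hUo : IsOpen U := isOpen_lt continuous_const Complex.continuous_re
  have hfin : ∀ s : ℂ, DifferentiableAt ℂ
      (fun s : ℂ => ∑ n ∈ Finset.Icc 1 M, f n * (n : ℂ) ^ (-s)) s := by
    intro s
    refine DifferentiableAt.fun_sum fun n hn => ?_
    have : (n : ℂ) ≠ 0 := by
      have := (Finset.mem_Icc.mp hn).1
      exact_mod_cast (by omega : n ≠ 0)
    exact (differentiableAt_id.neg.const_cpow (Or.inl this)).const_mul _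
  have heq : EqOn (fun s => G s - ∑ n ∈ Finset.Icc 1 M, f n * (n : ℂ) ^ (-s))
      (fun s => s * mellin T (-s)) U := by
    refine AnalyticOnNhd.eqOn_of_preconnected_of_eventuallyEq
      (DifferentiableOn.analyticOnNhd (fun s hs => ((hd s hs).sub (hfin s)).differentiableWithinAt)
        hUo)
      (DifferentiableOn.analyticOnNhd (fun s hs => (hdiff s hs).differentiableWithinAt) hUo)
      (convex_halfSpace_re_gt θ).isPreconnected (z₀ := ((max θ 1 + 1 : ℝ) : ℂ)) ?_ ?_
    · simp only [hU, mem_ofPred_eq, ofReal_re]; linarith [le_max_left θ 1]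
    · have : {s : ℂ | max θ 1 < s.re} ∈ 𝓝 ((max θ 1 + 1 : ℝ) : ℂ) :=
        (isOpen_lt continuous_const Complex.continuous_re).mem_nhds
          (show max θ 1 < ((max θ 1 + 1 : ℝ) : ℂ).re by rw [ofReal_re]; linarith)
      filter_upwards [this] with s hs
      have hs1 : 1 < s.re := (le_max_right _ _).trans_lt hs
      rw [hG s hs1, ← hL₁ s hs, ← hL₂ s]
      conv_lhs => rw [← hf, LSeries_add (hS₁ s hs1) (hS₂ s)]
      rw [add_sub_cancel_right]
  have h := heq (show (σ : ℂ) ∈ U by simpa [hU] using hσ)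
  simp only at h
  rw [h, norm_mul, norm_real, Real.norm_of_nonneg (hθ.trans hσ.le), hmel]
  have hint : ‖∫ t in Ioi (M : ℝ), T t * (t : ℂ) ^ (-((σ : ℂ) + 1))‖ ≤
      ∫ t in Ioi (M : ℝ), 2 * B * t ^ (θ - σ - 1) := by
    refine norm_integral_le_of_norm_le
      ((integrableOn_Ioi_rpow_of_lt (by linarith) hMpos).const_mul _) ?_
    refine (ae_restrict_iff' measurableSet_Ioi).mpr (Eventually.of_forall fun t ht => ?_)
    have ht0 : 0 < t := hMpos.trans ht
    rw [norm_mul, norm_cpow_eq_rpow_re_of_pos ht0,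
      show (-((σ : ℂ) + 1)).re = -σ - 1 by simp; ring]
    calc _ ≤ 2 * B * t ^ θ * t ^ (-σ - 1) := by
          gcongr
          exact hTB t (le_of_lt ht)
      _ = _ := by rw [mul_assoc, ← Real.rpow_add ht0]; congr 2; ring
  rw [integral_const_mul, integral_Ioi_rpow_of_lt (by linarith) hMpos] at hint
  have hσ0 : 0 ≤ σ := hθ.trans hσ.le
  calc _ ≤ σ * _ := mul_le_mul_of_nonneg_left hint hσ0
    _ = _ := by
      rw [show θ - σ - 1 + 1 = -(σ - θ) by ring, neg_sub]
      have : σ - θ ≠ 0 := by linarith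
      have : θ - σ ≠ 0 := by linarith
      field_simp
      ring

/-- Dirichlet's hyperbola method. -/
theorem sum_Ioc_mul_eq_hyperbola {R : Type*} [CommRing R] (f g : ArithmeticFunction R) {N U : ℕ}
    (hU : 0 < U) (hUN : U ≤ N) :
    ∑ n ∈ Finset.Ioc 0 N, (f * g) n =
      ∑ a ∈ Finset.Ioc 0 U, f a * ∑ b ∈ Finset.Ioc 0 (N / a), g b +
      ∑ b ∈ Finset.Ioc 0 (N / U), g b *
        (∑ a ∈ Finset.Ioc 0 (N / b), f a - ∑ a ∈ Finset.Ioc 0 U, f a) := by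
  rw [ArithmeticFunction.sum_Ioc_mul_eq_sum_sum,
    ← Finset.Ioc_union_Ioc_eq_Ioc (Nat.zero_le U) hUN,
    Finset.sum_union (Finset.Ioc_disjoint_Ioc_of_le le_rfl)]
  congr 1
  have h : ∀ b ∈ Finset.Ioc 0 (N / U),
      ∑ a ∈ Finset.Ioc 0 (N / b), f a - ∑ a ∈ Finset.Ioc 0 U, f a =
        ∑ a ∈ Finset.Ioc U (N / b), f a := by
    intro b hb
    obtain ⟨hb0, hb1⟩ := Finset.mem_Ioc.mp hb
    have : U ≤ N / b := by
      rw [Nat.le_div_iff_mul_le hb0, mul_comm]; exact (Nat.le_div_iff_mul_le hU).mp hb1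
    rw [← Finset.Ioc_union_Ioc_eq_Ioc (Nat.zero_le U) this,
      Finset.sum_union (Finset.Ioc_disjoint_Ioc_of_le le_rfl), add_sub_cancel_left]
  rw [Finset.sum_congr rfl fun b hb => congrArg (g b * ·) (h b hb)]
  simp only [Finset.mul_sum]
  rw [Finset.sum_comm']
  · exact Finset.sum_congr rfl fun b _ => Finset.sum_congr rfl fun a _ => mul_comm _ _
  · intro a b
    simp only [Finset.mem_Ioc]
    constructor
    · rintro ⟨⟨h1, h2⟩, h3, h4⟩
      have ha : 0 < a := by omega
      have h5 := (Nat.le_div_iff_mul_le ha).mp h4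
      refine ⟨⟨h1, ?_⟩, h3, ?_⟩
      · rw [Nat.le_div_iff_mul_le h3, mul_comm]; exact h5
      · rw [Nat.le_div_iff_mul_le hU]; nlinarith
    · rintro ⟨⟨h1, h2⟩, h3, h4⟩
      have ha : 0 < a := by omega
      have h5 := (Nat.le_div_iff_mul_le h3).mp h2
      refine ⟨⟨h1, ?_⟩, h3, ?_⟩
      · nlinarith
      · rw [Nat.le_div_iff_mul_le ha, mul_comm]; exact h5

theorem norm_sum_Ioc_mul_le {f g : ArithmeticFunction ℂ} {N U : ℕ} (hU : 0 < U) (hUN : U ≤ N)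
    {A : ℝ} (hf : ∀ n, ‖f n‖ ≤ 1) (hF : ∀ n, ‖∑ a ∈ Finset.Ioc 0 n, f a‖ ≤ A) {H : ℝ}
    (hG : ∀ n ≤ N, ‖∑ b ∈ Finset.Ioc 0 n, g b‖ ≤ H) :
    ‖∑ n ∈ Finset.Ioc 0 N, (f * g) n‖ ≤
      U * H + 2 * A * ∑ b ∈ Finset.Ioc 0 (N / U), ‖g b‖ := by
  rw [sum_Ioc_mul_eq_hyperbola f g hU hUN]
  refine (norm_add_le _ _).trans (add_le_add ?_ ?_)
  · refine (norm_sum_le _ _).trans ((Finset.sum_le_sum (g := fun _ => H) fun a _ => ?_).trans ?_)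
    · rw [norm_mul]
      calc _ ≤ 1 * H := by
            gcongr
            · exact hf a
            · exact hG _ (Nat.div_le_self _ _)
        _ = H := one_mul _
    · simp
  · refine (norm_sum_le _ _).trans ?_
    rw [Finset.mul_sum]
    refine Finset.sum_le_sum fun b _ => ?_
    rw [norm_mul, mul_comm]
    gcongr
    refine (norm_sub_le _ _).trans ?_
    linarith [hF (N / b), hF U]

/-- Bounded coefficient sums of two bounded sequences give square root bounds for their
Dirichlet convolution. -/
theorem norm_sum_Ioc_mul_le_sqrt {f g : ArithmeticFunction ℂ} {P : ℝ} (hf : ∀ n, ‖f n‖ ≤ 1)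
    (hg : ∀ n, ‖g n‖ ≤ 1) (hF : ∀ n, ‖∑ a ∈ Finset.Ioc 0 n, f a‖ ≤ P)
    (hG : ∀ n, ‖∑ a ∈ Finset.Ioc 0 n, g a‖ ≤ P) (N : ℕ) :
    ‖∑ n ∈ Finset.Ioc 0 N, (f * g) n‖ ≤ 7 * P * Real.sqrt N := by
  rcases Nat.eq_zero_or_pos N with rfl | hN
  · simp
  have hP : 0 ≤ P := (norm_nonneg _).trans (hF 0)
  have hU : 0 < Nat.sqrt N := Nat.sqrt_pos.mpr hN
  have h := norm_sum_Ioc_mul_le hU (Nat.sqrt_le_self N) hf hF (fun n _ => hG n)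
  have h1 : ∑ b ∈ Finset.Ioc 0 (N / Nat.sqrt N), ‖g b‖ ≤ ((N / Nat.sqrt N : ℕ) : ℝ) := by
    refine (Finset.sum_le_sum fun b _ => hg b).trans ?_
    simp
  have h2 : N / Nat.sqrt N ≤ Nat.sqrt N + 2 := by
    have := Nat.sqrt_le_add N
    refine Nat.div_le_of_le_mul ?_
    nlinarith
  have h3 : ((N / Nat.sqrt N : ℕ) : ℝ) ≤ Nat.sqrt N + 2 := by exact_mod_cast h2
  have h4 : (Nat.sqrt N : ℝ) ≤ Real.sqrt N := Real.nat_sqrt_le_real_sqrt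
  have h5 : (1 : ℝ) ≤ Real.sqrt N := Real.one_le_sqrt.mpr (by exact_mod_cast hN)
  have h6 : 2 * P * ∑ b ∈ Finset.Ioc 0 (N / Nat.sqrt N), ‖g b‖ ≤ 2 * P * (3 * Real.sqrt N) := by
    gcongr; linarith
  have h7 : (Nat.sqrt N : ℝ) * P ≤ Real.sqrt N * P := by gcongr
  linarith

theorem sum_Ioc_norm_mul_le {f g : ArithmeticFunction ℂ} {C δ : ℝ} (hδ : 0 < δ)
    (hf : ∀ n, ‖f n‖ ≤ 1)
    (hg : ∀ n : ℕ, ∑ a ∈ Finset.Ioc 0 n, ‖g a‖ ≤ C * (n : ℝ) ^ (1 + δ)) (N : ℕ) :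
    ∑ n ∈ Finset.Ioc 0 N, ‖(f * g) n‖ ≤
      C * (∑' n : ℕ, 1 / (n : ℝ) ^ (1 + δ)) * (N : ℝ) ^ (1 + δ) := by
  have hC : 0 ≤ C := by
    have := (Finset.sum_nonneg fun a _ => norm_nonneg (g a)).trans (hg 1)
    simpa using this
  set z : ArithmeticFunction ℝ := ⟨fun n => if n = 0 then 0 else 1, by simp⟩ with hz
  set g' : ArithmeticFunction ℝ := ⟨fun n => ‖g n‖, by simp⟩ with hg'
  have h1 : ∀ n, ‖(f * g) n‖ ≤ (z * g') n := by
    intro n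
    rw [ArithmeticFunction.mul_apply, ArithmeticFunction.mul_apply]
    refine (norm_sum_le _ _).trans (Finset.sum_le_sum fun p hp => ?_)
    rw [norm_mul]
    have : p.1 ≠ 0 := (Nat.ne_zero_of_mem_divisorsAntidiagonal hp).1
    have h2 : z p.1 = 1 := by simp [hz, this]
    rw [h2]
    exact mul_le_mul_of_nonneg_right (hf _) (norm_nonneg _)
  have hsum : Summable fun n : ℕ => 1 / (n : ℝ) ^ (1 + δ) :=
    Real.summable_one_div_nat_rpow.mpr (by linarith)
  calc _ ≤ ∑ n ∈ Finset.Ioc 0 N, (z * g') n := Finset.sum_le_sum fun n _ => h1 n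
    _ = ∑ a ∈ Finset.Ioc 0 N, z a * ∑ b ∈ Finset.Ioc 0 (N / a), g' b :=
        ArithmeticFunction.sum_Ioc_mul_eq_sum_sum _ _ _
    _ ≤ ∑ a ∈ Finset.Ioc 0 N, C * (N : ℝ) ^ (1 + δ) * (1 / (a : ℝ) ^ (1 + δ)) := by
        refine Finset.sum_le_sum fun a ha => ?_
        have ha0 : 0 < a := (Finset.mem_Ioc.mp ha).1
        have h2 : z a = 1 := by simp [hz, ha0.ne']
        rw [h2, one_mul]
        calc _ ≤ C * ((N / a : ℕ) : ℝ) ^ (1 + δ) := hg _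
          _ ≤ C * ((N : ℝ) / a) ^ (1 + δ) := by
              gcongr
              exact Nat.cast_div_le
          _ = _ := by rw [Real.div_rpow (Nat.cast_nonneg _) (Nat.cast_nonneg _)]; ring
    _ = C * (N : ℝ) ^ (1 + δ) * ∑ a ∈ Finset.Ioc 0 N, 1 / (a : ℝ) ^ (1 + δ) := by
        rw [Finset.mul_sum]
    _ ≤ C * (N : ℝ) ^ (1 + δ) * ∑' n : ℕ, 1 / (n : ℝ) ^ (1 + δ) := by
        gcongr
        exact hsum.sum_le_tsum _ fun n _ => by positivity
    _ = _ := by ring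

/-- Coefficient sums of the triple convolution `f₁ * (f₂ * f₃)` where `f₁` has sums bounded by `A`
and `f₂`, `f₃` have sums bounded by `P`. -/
theorem norm_sum_Ioc_triple_mul_le {f₁ f₂ f₃ : ArithmeticFunction ℂ} {A P η : ℝ} (hη : 0 < η)
    (hη1 : η ≤ 1)
    (h₁ : ∀ n, ‖f₁ n‖ ≤ 1) (h₂ : ∀ n, ‖f₂ n‖ ≤ 1) (h₃ : ∀ n, ‖f₃ n‖ ≤ 1)
    (hA : ∀ n, ‖∑ a ∈ Finset.Ioc 0 n, f₁ a‖ ≤ A) (hP₂ : ∀ n, ‖∑ a ∈ Finset.Ioc 0 n, f₂ a‖ ≤ P)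
    (hP₃ : ∀ n, ‖∑ a ∈ Finset.Ioc 0 n, f₃ a‖ ≤ P) {N : ℕ} (hN : 0 < N) :
    ‖∑ n ∈ Finset.Ioc 0 N, (f₁ * (f₂ * f₃)) n‖ ≤
      14 * P * (N : ℝ) ^ (1 / 2 + η) +
        2 * A * (∑' n : ℕ, 1 / (n : ℝ) ^ (1 + η)) * (N : ℝ) ^ (1 - η ^ 2) := by
  have hN0 : (0 : ℝ) < N := by exact_mod_cast hN
  have hN1 : (1 : ℝ) ≤ N := by exact_mod_cast hN
  have hP : 0 ≤ P := (norm_nonneg _).trans (hP₂ 0)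
  have hA0 : 0 ≤ A := (norm_nonneg _).trans (hA 0)
  have hNη : 1 ≤ (N : ℝ) ^ η := Real.one_le_rpow hN1 hη.le
  set U : ℕ := ⌈(N : ℝ) ^ η⌉₊ with hU
  have hU0 : 0 < U := Nat.ceil_pos.mpr (by linarith)
  have hUN : U ≤ N := by
    refine Nat.ceil_le.mpr ?_
    calc (N : ℝ) ^ η ≤ (N : ℝ) ^ (1 : ℝ) := Real.rpow_le_rpow_of_exponent_le hN1 hη1
      _ = N := Real.rpow_one _
  have hUle : (U : ℝ) ≤ 2 * (N : ℝ) ^ η := by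
    have := Nat.ceil_lt_add_one (show 0 ≤ (N : ℝ) ^ η by linarith)
    linarith
  have hUge : (N : ℝ) ^ η ≤ U := Nat.le_ceil _
  have habs : ∀ n : ℕ, ∑ b ∈ Finset.Ioc 0 n, ‖(f₂ * f₃) b‖ ≤
      1 * (∑' n : ℕ, 1 / (n : ℝ) ^ (1 + η)) * (n : ℝ) ^ (1 + η) := by
    refine sum_Ioc_norm_mul_le hη h₂ fun n => ?_
    rcases Nat.eq_zero_or_pos n with rfl | hn
    · simp [Real.zero_rpow (show 1 + η ≠ 0 by linarith)]
    calc _ ≤ ∑ a ∈ Finset.Ioc 0 n, (1 : ℝ) := Finset.sum_le_sum fun a _ => h₃ a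
      _ = (n : ℝ) ^ (1 : ℝ) := by simp
      _ ≤ (n : ℝ) ^ (1 + η) :=
          Real.rpow_le_rpow_of_exponent_le (by exact_mod_cast hn) (by linarith)
      _ = _ := (one_mul _).symm
  have hZ : 0 ≤ ∑' n : ℕ, 1 / (n : ℝ) ^ (1 + η) := tsum_nonneg fun n => by positivity
  refine (norm_sum_Ioc_mul_le hU0 hUN h₁ hA (H := 7 * P * Real.sqrt N) fun n hn => ?_).trans
    (add_le_add ?_ ?_)
  · refine (norm_sum_Ioc_mul_le_sqrt h₂ h₃ hP₂ hP₃ n).trans ?_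
    gcongr
  · calc (U : ℝ) * (7 * P * Real.sqrt N) ≤ 2 * (N : ℝ) ^ η * (7 * P * (N : ℝ) ^ (1 / 2 : ℝ)) := by
          rw [Real.sqrt_eq_rpow]; gcongr
      _ = _ := by rw [Real.rpow_add hN0]; ring
  · calc _ ≤ 2 * A * (1 * (∑' n : ℕ, 1 / (n : ℝ) ^ (1 + η)) * ((N / U : ℕ) : ℝ) ^ (1 + η)) := by
          gcongr; exact habs _
      _ ≤ 2 * A * (1 * (∑' n : ℕ, 1 / (n : ℝ) ^ (1 + η)) * ((N : ℝ) ^ (1 - η)) ^ (1 + η)) := by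
          gcongr
          refine Nat.cast_div_le.trans ?_
          rw [Real.rpow_sub hN0, Real.rpow_one]
          gcongr
      _ = _ := by rw [← Real.rpow_mul hN0.le]; ring_nf

theorem rpow_neg_mul_le_sub_le {β a b : ℝ} (hβ0 : 0 < β) (hβ1 : β < 1) (ha : 0 < a)
    (hab : a ≤ b) :
    b ^ (-β) * (b - a) ≤ b ^ (1 - β) / (1 - β) - a ^ (1 - β) / (1 - β) ∧
      b ^ (1 - β) / (1 - β) - a ^ (1 - β) / (1 - β) ≤ a ^ (-β) * (b - a) := by
  rcases hab.eq_or_lt with rfl | hab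
  · simp
  have hd : ∀ x : ℝ, 0 < x → HasDerivAt (fun t : ℝ => t ^ (1 - β) / (1 - β)) (x ^ (-β)) x := by
    intro x hx
    have h := (Real.hasDerivAt_rpow_const (p := 1 - β) (Or.inl hx.ne')).div_const (1 - β)
    have h0 : 1 - β ≠ 0 := by linarith
    rwa [mul_div_cancel_left₀ _ h0, show 1 - β - 1 = -β by ring] at h
  obtain ⟨c, ⟨hc1, hc2⟩, hc⟩ := exists_hasDerivAt_eq_slope
    (fun t : ℝ => t ^ (1 - β) / (1 - β)) (fun x => x ^ (-β)) hab
    (fun x hx => (hd x (ha.trans_le hx.1)).continuousAt.continuousWithinAt)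
    (fun x hx => hd x (ha.trans hx.1))
  have hba : 0 < b - a := by linarith
  rw [eq_div_iff hba.ne'] at hc
  rw [← hc]
  have hc0 : 0 < c := ha.trans hc1
  constructor
  · exact mul_le_mul_of_nonneg_right
      (Real.rpow_le_rpow_of_nonpos hc0 hc2.le (by linarith)) hba.le
  · exact mul_le_mul_of_nonneg_right
      (Real.rpow_le_rpow_of_nonpos ha hc1.le (by linarith)) hba.le

/-- The partial sums of `∑ n ^ (-β)` for `0 < β < 1`, with a negative second term `c = ζ(β)`. -/
theorem exists_neg_sum_rpow_neg_approx {β : ℝ} (hβ0 : 0 < β) (hβ1 : β < 1) :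
    ∃ c < 0, ∀ y : ℝ, 1 ≤ y →
      |∑ n ∈ Finset.Ioc 0 ⌊y⌋₊, (n : ℝ) ^ (-β) - y ^ (1 - β) / (1 - β) - c| ≤
        4 * y ^ (-β) := by
  set u : ℕ → ℝ := fun n => ∑ k ∈ Finset.Ioc 0 (n + 1), (k : ℝ) ^ (-β) -
    ((n + 1 : ℕ) : ℝ) ^ (1 - β) / (1 - β) with hu
  set l : ℕ → ℝ := fun n => u n - ((n + 1 : ℕ) : ℝ) ^ (-β) with hl
  have hstep : ∀ n : ℕ, u (n + 1) - u n = ((n + 1 + 1 : ℕ) : ℝ) ^ (-β) -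
      (((n + 1 + 1 : ℕ) : ℝ) ^ (1 - β) / (1 - β) - ((n + 1 : ℕ) : ℝ) ^ (1 - β) / (1 - β)) := by
    intro n
    simp only [hu]
    rw [Finset.sum_Ioc_succ_top (Nat.zero_le (n + 1))]
    ring
  have hmvt : ∀ n : ℕ, _ := fun n => rpow_neg_mul_le_sub_le hβ0 hβ1
    (a := ((n + 1 : ℕ) : ℝ)) (b := ((n + 1 + 1 : ℕ) : ℝ)) (by positivity)
    (by push_cast; linarith)
  have hone : ∀ n : ℕ, ((n + 1 + 1 : ℕ) : ℝ) - ((n + 1 : ℕ) : ℝ) = 1 := by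
    intro n; push_cast; ring
  have hanti : Antitone u := antitone_nat_of_succ_le fun n => by
    have := (hmvt n).1
    rw [hone, mul_one] at this
    linarith [hstep n]
  have hmono : Monotone l := monotone_nat_of_le_succ fun n => by
    have := (hmvt n).2
    rw [hone, mul_one] at this
    simp only [hl]
    linarith [hstep n]
  have hlu : ∀ n m, l n ≤ u m := by
    intro n m
    have h1 := hmono (le_max_left n m)
    have h2 := hanti (le_max_right n m)
    have h3 : l (max n m) ≤ u (max n m) := by
      simp only [hl]
      linarith [Real.rpow_nonneg (Nat.cast_nonneg (max n m + 1) : (0 : ℝ) ≤ _) (-β)]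
    linarith
  have hbdd : BddBelow (Set.range u) := ⟨l 0, by rintro _ ⟨m, rfl⟩; exact hlu 0 m⟩
  refine ⟨⨅ n, u n, ?_, fun y hy => ?_⟩
  · refine (ciInf_le hbdd 0).trans_lt ?_
    have : (1 - β)⁻¹ > 1 := (one_lt_inv₀ (by linarith)).mpr (by linarith)
    simp [hu]
    linarith
  · obtain ⟨n, hn⟩ := Nat.exists_eq_succ_of_ne_zero (Nat.floor_pos.mpr hy).ne'
    have h1 : (⨅ n, u n) ≤ u n := ciInf_le hbdd n
    have h2 : l n ≤ ⨅ n, u n := le_ciInf fun m => hlu n m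
    have hy1 : ((n + 1 : ℕ) : ℝ) ≤ y := by
      have := Nat.floor_le (show 0 ≤ y by linarith); rwa [hn] at this
    have hy2 : y < ((n + 1 : ℕ) : ℝ) + 1 := by
      have := Nat.lt_floor_add_one y; rwa [hn] at this
    have h3 := rpow_neg_mul_le_sub_le hβ0 hβ1 (a := ((n + 1 : ℕ) : ℝ)) (by positivity) hy1
    have hpos : 0 < ((n + 1 : ℕ) : ℝ) ^ (-β) := by positivity
    have h4 : ((n + 1 : ℕ) : ℝ) ^ (-β) * (y - ((n + 1 : ℕ) : ℝ)) ≤ ((n + 1 : ℕ) : ℝ) ^ (-β) :=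
      mul_le_of_le_one_right hpos.le (by linarith)
    have h5 : 0 ≤ y ^ (-β) * (y - ((n + 1 : ℕ) : ℝ)) :=
      mul_nonneg (by positivity) (by linarith)
    have h6 : ((n + 1 : ℕ) : ℝ) ^ (-β) ≤ 2 * y ^ (-β) := by
      have hn1 : (1 : ℝ) ≤ ((n + 1 : ℕ) : ℝ) := by push_cast; linarith [Nat.cast_nonneg (α := ℝ) n]
      calc ((n + 1 : ℕ) : ℝ) ^ (-β) ≤ (y / 2) ^ (-β) :=
            Real.rpow_le_rpow_of_nonpos (by linarith) (by linarith) (by linarith)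
        _ = y ^ (-β) * 2 ^ β := by
            rw [Real.div_rpow (by linarith) (by norm_num), Real.rpow_neg (by norm_num : (0:ℝ) ≤ 2),
              div_inv_eq_mul]
        _ ≤ y ^ (-β) * 2 ^ (1 : ℝ) := by
            gcongr
            norm_num
        _ = _ := by rw [Real.rpow_one, mul_comm]
    have hsum : ∑ k ∈ Finset.Ioc 0 ⌊y⌋₊, (k : ℝ) ^ (-β) =
        u n + ((n + 1 : ℕ) : ℝ) ^ (1 - β) / (1 - β) := by
      rw [hn]; simp only [hu, Nat.succ_eq_add_one]; ring
    rw [hsum, abs_le]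
    simp only [hl] at h2
    constructor <;> linarith [h3.1, h3.2]

theorem sum_Ioc_mul_rpow {f g : ArithmeticFunction ℂ} {β : ℝ} {M N : ℕ} (hM : 0 < M)
    (hMN : M ≤ N) :
    ∑ n ∈ Finset.Ioc 0 N, (f * g) n * (((n : ℝ) ^ (-β) : ℝ) : ℂ) =
      ∑ m ∈ Finset.Ioc 0 M, f m * (((m : ℝ) ^ (-β) : ℝ) : ℂ) *
        ∑ n ∈ Finset.Ioc 0 (N / m), g n * (((n : ℝ) ^ (-β) : ℝ) : ℂ) +
      ∑ n ∈ Finset.Ioc 0 (N / M), g n * (((n : ℝ) ^ (-β) : ℝ) : ℂ) *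
        (∑ m ∈ Finset.Ioc 0 (N / n), f m * (((m : ℝ) ^ (-β) : ℝ) : ℂ) -
          ∑ m ∈ Finset.Ioc 0 M, f m * (((m : ℝ) ^ (-β) : ℝ) : ℂ)) := by
  set tw : ArithmeticFunction ℂ → ArithmeticFunction ℂ :=
    fun f => ⟨fun n => f n * (((n : ℝ) ^ (-β) : ℝ) : ℂ), by simp⟩
  have htwa : ∀ f n, tw f n = f n * (((n : ℝ) ^ (-β) : ℝ) : ℂ) := fun _ _ => rfl
  have h := sum_Ioc_mul_eq_hyperbola (tw f) (tw g) hM hMN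
  have h2 : tw f * tw g = tw (f * g) := by
    ext n
    rw [htwa, ArithmeticFunction.mul_apply, ArithmeticFunction.mul_apply, Finset.sum_mul]
    simp only [htwa]
    refine Finset.sum_congr rfl fun p hp => ?_
    rw [← (Nat.mem_divisorsAntidiagonal.mp hp).1, Nat.cast_mul,
      Real.mul_rpow (Nat.cast_nonneg _) (Nat.cast_nonneg _)]
    push_cast; ring
  rw [h2] at h
  exact h

theorem natCast_cpow_neg_ofReal (n : ℕ) (σ : ℝ) :
    (n : ℂ) ^ (-σ : ℂ) = (((n : ℝ) ^ (-σ) : ℝ) : ℂ) := by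
  rw [Complex.ofReal_cpow (Nat.cast_nonneg n)]; push_cast; rfl

/-- A lower bound for the value at `1` of an L-series with coefficients `k` such that `ζ * k` is
nonnegative, given that its value at some `β < 1` is nonnegative. -/
theorem exists_one_le_re_mul_add {θ β : ℝ} (hθ : 0 ≤ θ) (hθβ : θ < β) (hβ : β < 1) :
    ∃ D > 0, ∀ (k : ArithmeticFunction ℂ) (G : ℂ → ℂ) (B W : ℝ) (M N : ℕ),
      0 < M → M ≤ N → (∀ n ≥ M, ‖∑ m ∈ Finset.Ioc 0 n, k m‖ ≤ B * (n : ℝ) ^ θ) →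
      ∑ m ∈ Finset.Ioc 0 M, ‖k m‖ ≤ W →
      (∀ s : ℂ, 1 < s.re → LSeriesSummable (k ·) s) →
      (∀ s : ℂ, 1 < s.re → G s = LSeries (k ·) s) →
      (∀ s : ℂ, θ < s.re → DifferentiableAt ℂ G s) →
      (∀ n, 0 ≤ ((k * (ArithmeticFunction.zeta : ArithmeticFunction ℂ)) n).re) →
      (k * (ArithmeticFunction.zeta : ArithmeticFunction ℂ)) 1 = 1 → 0 ≤ (G β).re →
      1 ≤ (G 1).re * ((N : ℝ) ^ (1 - β) / (1 - β)) +
        D * (B * ((N : ℝ) ^ (1 - β) * (M : ℝ) ^ (θ - 1) +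
          (M : ℝ) ^ (θ - β) * ((N : ℝ) / M) ^ (1 - β)) + W * (N : ℝ) ^ (-β)) := by
  have hβ0 : 0 < β := hθ.trans_lt hθβ
  obtain ⟨c, hc, hzeta⟩ := exists_neg_sum_rpow_neg_approx hβ0 hβ
  have e1 : 0 < 1 - β := by linarith
  have e2 : 0 < 1 - θ := by linarith
  have e3 : 0 < β - θ := by linarith
  set D₁ : ℝ := 2 * (1 / (1 - θ)) / (1 - β) with hD₁
  set D₂ : ℝ := (-c + 2 * (1 / (1 - β) + 4)) * (2 * (β / (β - θ))) with hD₂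
  have hD₁0 : 0 < D₁ := by positivity
  have hD₂0 : 0 < D₂ := by
    have : 0 < 1 / (1 - β) := by positivity
    have : 0 < -c + 2 * (1 / (1 - β) + 4) := by linarith
    positivity
  refine ⟨D₁ + D₂ + 4, by positivity, ?_⟩
  intro k G B W M N hM hMN hB hW hS hG hd hpos hone hGβ
  have hM0 : (0 : ℝ) < M := by exact_mod_cast hM
  have hN0 : (0 : ℝ) < N := by exact_mod_cast hM.trans_le hMN
  have hNM : (1 : ℝ) ≤ (N : ℝ) / M := (one_le_div hM0).mpr (by exact_mod_cast hMN)
  have hB0 : 0 ≤ B := nonneg_of_mul_nonneg_left ((norm_nonneg _).trans (hB M le_rfl))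
    (Real.rpow_pos_of_pos hM0 _)
  have hIcc : ∀ n : ℕ, Finset.Icc 1 n = Finset.Ioc 0 n := fun n => rfl
  set w : ℕ → ℂ := fun n => (((n : ℝ) ^ (-β) : ℝ) : ℂ) with hw
  set K : ℕ → ℂ := fun n => ∑ m ∈ Finset.Ioc 0 n, k m * w m with hK
  set E : ℝ := 2 * B * (β / (β - θ)) * (M : ℝ) ^ (θ - β) with hE
  have hE0 : 0 ≤ E := by positivity
  have hKn : ∀ n ≥ M, ‖G β - K n‖ ≤ E := by
    intro n hn
    have h := norm_continuation_sub_sum_le hθ (hM.trans_le hn)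
      (fun m hm => by rw [hIcc]; exact hB m (hn.trans hm)) hS hG hd hθβ
    simp only [natCast_cpow_neg_ofReal, hIcc] at h
    refine h.trans ?_
    simp only [hE]
    have : (n : ℝ) ^ (θ - β) ≤ (M : ℝ) ^ (θ - β) :=
      Real.rpow_le_rpow_of_nonpos hM0 (by exact_mod_cast hn) (by linarith)
    gcongr
  have hK1 : ‖G 1 - ∑ m ∈ Finset.Ioc 0 M, k m * (((m : ℝ)⁻¹ : ℝ) : ℂ)‖ ≤
      2 * B * (1 / (1 - θ)) * (M : ℝ) ^ (θ - 1) := by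
    have h := norm_continuation_sub_sum_le (σ := 1) hθ hM
      (fun m hm => by rw [hIcc]; exact hB m hm) hS hG hd (by linarith)
    simp only [natCast_cpow_neg_ofReal, hIcc, Real.rpow_neg_one] at h
    simpa using h
  have hmain := sum_Ioc_mul_rpow (f := k) (g := (ArithmeticFunction.zeta : ArithmeticFunction ℂ))
    (β := β) hM hMN
  have hz : ∀ L : ℕ, ∑ n ∈ Finset.Ioc 0 L, (ArithmeticFunction.zeta : ArithmeticFunction ℂ) n *
      (((n : ℝ) ^ (-β) : ℝ) : ℂ) = ((∑ n ∈ Finset.Ioc 0 L, (n : ℝ) ^ (-β) : ℝ) : ℂ) := by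
    intro L
    rw [Complex.ofReal_sum]
    refine Finset.sum_congr rfl fun n hn => ?_
    have : n ≠ 0 := by have := (Finset.mem_Ioc.mp hn).1; omega
    simp [ArithmeticFunction.natCoe_apply, this]
  simp only [hz] at hmain
  have hLHS : 1 ≤ (∑ n ∈ Finset.Ioc 0 N,
      (k * (ArithmeticFunction.zeta : ArithmeticFunction ℂ)) n * w n).re := by
    rw [Complex.re_sum]
    have hterm : ∀ n, 0 ≤ ((k * (ArithmeticFunction.zeta : ArithmeticFunction ℂ)) n * w n).re := by
      intro n
      simp only [hw, Complex.re_mul_ofReal]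
      exact mul_nonneg (hpos n) (by positivity)
    have h1 : 1 ∈ Finset.Ioc 0 N := Finset.mem_Ioc.mpr ⟨one_pos, by omega⟩
    refine le_trans ?_ (Finset.single_le_sum (fun n _ => hterm n) h1)
    rw [hone]; simp [hw]
  rw [hmain, Complex.add_re] at hLHS
  have hfirst : (∑ m ∈ Finset.Ioc 0 M, k m * w m *
      ((∑ n ∈ Finset.Ioc 0 (N / m), (n : ℝ) ^ (-β) : ℝ) : ℂ)).re ≤
      ((G 1).re + 2 * B * (1 / (1 - θ)) * (M : ℝ) ^ (θ - 1)) *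
        ((N : ℝ) ^ (1 - β) / (1 - β)) + (-c) * E + 4 * W * (N : ℝ) ^ (-β) := by
    set e : ℕ → ℝ := fun m => ∑ n ∈ Finset.Ioc 0 (N / m), (n : ℝ) ^ (-β) -
      ((N : ℝ) / m) ^ (1 - β) / (1 - β) - c with he
    have heq : ∑ m ∈ Finset.Ioc 0 M, k m * w m *
        ((∑ n ∈ Finset.Ioc 0 (N / m), (n : ℝ) ^ (-β) : ℝ) : ℂ) =
        (∑ m ∈ Finset.Ioc 0 M, k m * (((m : ℝ)⁻¹ : ℝ) : ℂ)) *
          (((N : ℝ) ^ (1 - β) / (1 - β) : ℝ) : ℂ) + K M * (c : ℂ) +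
        ∑ m ∈ Finset.Ioc 0 M, k m * w m * (e m : ℂ) := by
      simp only [hK, Finset.sum_mul]
      rw [← Finset.sum_add_distrib, ← Finset.sum_add_distrib]
      refine Finset.sum_congr rfl fun m hm => ?_
      have hm0 : (0 : ℝ) < m := by exact_mod_cast (Finset.mem_Ioc.mp hm).1
      have h1 : (m : ℝ) ^ (-β) * (((N : ℝ) / m) ^ (1 - β) / (1 - β)) =
          (m : ℝ)⁻¹ * ((N : ℝ) ^ (1 - β) / (1 - β)) := by
        rw [Real.div_rpow hN0.le hm0.le, Real.rpow_sub hm0, Real.rpow_neg hm0.le, Real.rpow_one]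
        have := (Real.rpow_pos_of_pos hm0 β).ne'
        field_simp
      have h2 : ∑ n ∈ Finset.Ioc 0 (N / m), (n : ℝ) ^ (-β) =
          ((N : ℝ) / m) ^ (1 - β) / (1 - β) + c + e m := by simp only [he]; ring
      rw [h2, mul_assoc (k m) (((m : ℝ)⁻¹ : ℝ) : ℂ), ← Complex.ofReal_mul, ← h1]
      simp only [hw]
      push_cast; ring
    have hebd : ∀ m ∈ Finset.Ioc 0 M, ‖k m * w m * (e m : ℂ)‖ ≤ ‖k m‖ * (4 * (N : ℝ) ^ (-β)) := by
      intro m hm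
      obtain ⟨hm1, hm2⟩ := Finset.mem_Ioc.mp hm
      have hm0 : (0 : ℝ) < m := by exact_mod_cast hm1
      have h := hzeta ((N : ℝ) / m) ((one_le_div hm0).mpr (by exact_mod_cast hm2.trans hMN))
      rw [Nat.floor_div_eq_div] at h
      rw [norm_mul, norm_mul, mul_assoc]
      refine mul_le_mul_of_nonneg_left ?_ (norm_nonneg _)
      simp only [hw, Complex.norm_real, Real.norm_eq_abs]
      rw [abs_of_nonneg (by positivity : (0 : ℝ) ≤ (m : ℝ) ^ (-β))]
      calc _ ≤ (m : ℝ) ^ (-β) * (4 * ((N : ℝ) / m) ^ (-β)) := by gcongr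
        _ = _ := by
          rw [Real.div_rpow hN0.le hm0.le]
          have := (Real.rpow_pos_of_pos hm0 (-β)).ne'
          field_simp
    have hesum : ‖∑ m ∈ Finset.Ioc 0 M, k m * w m * (e m : ℂ)‖ ≤ 4 * W * (N : ℝ) ^ (-β) := by
      refine (norm_sum_le _ _).trans ((Finset.sum_le_sum hebd).trans ?_)
      rw [← Finset.sum_mul]
      calc _ ≤ W * (4 * (N : ℝ) ^ (-β)) := by gcongr
        _ = _ := by ring
    rw [heq, Complex.add_re, Complex.add_re, Complex.re_mul_ofReal, Complex.re_mul_ofReal]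
    have t1 : (∑ m ∈ Finset.Ioc 0 M, k m * (((m : ℝ)⁻¹ : ℝ) : ℂ)).re ≤
        (G 1).re + 2 * B * (1 / (1 - θ)) * (M : ℝ) ^ (θ - 1) := by
      have := (Complex.abs_re_le_norm _).trans hK1
      rw [Complex.sub_re, abs_le] at this
      linarith [this.1]
    have t2 : (K M).re * c ≤ (-c) * E := by
      have := (Complex.abs_re_le_norm _).trans (hKn M le_rfl)
      rw [Complex.sub_re, abs_le] at this
      nlinarith [this.2]
    have t3 := (Complex.re_le_norm _).trans hesum
    have t4 := mul_le_mul_of_nonneg_right t1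
      (by positivity : (0 : ℝ) ≤ (N : ℝ) ^ (1 - β) / (1 - β))
    linarith
  have hVpow : ∑ n ∈ Finset.Ioc 0 (N / M), (n : ℝ) ^ (-β) ≤
      (1 / (1 - β) + 4) * ((N : ℝ) / M) ^ (1 - β) := by
    have h := hzeta _ hNM
    rw [Nat.floor_div_eq_div, abs_le] at h
    have h1 : ((N : ℝ) / M) ^ (-β) ≤ ((N : ℝ) / M) ^ (1 - β) :=
      Real.rpow_le_rpow_of_exponent_le hNM (by linarith)
    have h2 : (1 / (1 - β) + 4) * ((N : ℝ) / M) ^ (1 - β) =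
      ((N : ℝ) / M) ^ (1 - β) / (1 - β) + 4 * ((N : ℝ) / M) ^ (1 - β) := by ring
    linarith [h.2]
  have hsecond : (∑ n ∈ Finset.Ioc 0 (N / M),
      (ArithmeticFunction.zeta : ArithmeticFunction ℂ) n * w n * (K (N / n) - K M)).re ≤
      (1 / (1 - β) + 4) * ((N : ℝ) / M) ^ (1 - β) * (2 * E) := by
    refine (Complex.re_le_norm _).trans ((norm_sum_le _ _).trans ?_)
    refine le_trans ?_ (mul_le_mul_of_nonneg_right hVpow (by positivity : 0 ≤ 2 * E))
    rw [Finset.sum_mul]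
    refine Finset.sum_le_sum fun n hn => ?_
    obtain ⟨hn1, hn2⟩ := Finset.mem_Ioc.mp hn
    have hle : M ≤ N / n := by
      rw [Nat.le_div_iff_mul_le hn1, mul_comm]; exact (Nat.le_div_iff_mul_le hM).mp hn2
    have h1 : ‖K (N / n) - K M‖ ≤ 2 * E := by
      have := norm_sub_le (G β - K M) (G β - K (N / n))
      rw [sub_sub_sub_cancel_left] at this
      linarith [hKn _ hle, hKn M le_rfl]
    have h2 : ‖(ArithmeticFunction.zeta : ArithmeticFunction ℂ) n * w n‖ = (n : ℝ) ^ (-β) := by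
      have : n ≠ 0 := by omega
      simp only [hw, ArithmeticFunction.natCoe_apply, ArithmeticFunction.zeta_apply, this,
        if_false, Nat.cast_one, one_mul, Complex.norm_real]
      exact Real.norm_of_nonneg (by positivity)
    rw [norm_mul, h2]
    gcongr
  have hW0 : 0 ≤ W := (Finset.sum_nonneg fun m _ => norm_nonneg _).trans hW
  have hV1 : 1 ≤ ((N : ℝ) / M) ^ (1 - β) := Real.one_le_rpow hNM e1.le
  set V := ((N : ℝ) / M) ^ (1 - β) with hV
  set X := (N : ℝ) ^ (1 - β) with hX
  set Y := (N : ℝ) ^ (-β) with hY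
  set P := (M : ℝ) ^ (θ - 1) with hP
  set Q := (M : ℝ) ^ (θ - β) with hQ
  have hX0 : 0 ≤ X := by positivity
  have hY0 : 0 ≤ Y := by positivity
  have hP0 : 0 ≤ P := by positivity
  have hQ0 : 0 ≤ Q := by positivity
  have f1 : 2 * B * (1 / (1 - θ)) * P * (X / (1 - β)) = D₁ * (B * (X * P)) := by
    simp only [hD₁]; ring
  have f2 : (-c) * E + (1 / (1 - β) + 4) * V * (2 * E) ≤ D₂ * (B * (Q * V)) := by
    have h1 : (-c) * E ≤ (-c) * E * V :=
      le_mul_of_one_le_right (mul_nonneg (by linarith) hE0) hV1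
    have h2 : D₂ * (B * (Q * V)) =
        (-c) * E * V + (1 / (1 - β) + 4) * V * (2 * E) := by
      simp only [hD₂, hE]; ring
    linarith
  have g1 : 0 ≤ B * (X * P) := by positivity
  have g2 : 0 ≤ B * (Q * V) := by positivity
  have g3 : 0 ≤ W * Y := by positivity
  nlinarith [mul_nonneg hD₁0.le g1, mul_nonneg hD₁0.le g2, mul_nonneg hD₁0.le g3,
    mul_nonneg hD₂0.le g1, mul_nonneg hD₂0.le g2, mul_nonneg hD₂0.le g3]

section Positivity

open ArithmeticFunction
open scoped ComplexOrder

variable {q₁ q₂ q₃ : ℕ}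

/-- If `ψ = χ₁χ₂` on the natural numbers, then `χ₂ * ψ = χ₂ · (ζ * χ₁)`. -/
lemma toArithmeticFunction_mul_apply_eq {χ₁ : DirichletCharacter ℂ q₁}
    {χ₂ : DirichletCharacter ℂ q₂} {ψ : DirichletCharacter ℂ q₃}
    (hψ : ∀ n : ℕ, ψ n = χ₁ n * χ₂ n) (n : ℕ) :
    (toArithmeticFunction (χ₂ ·) * toArithmeticFunction (ψ ·)) n = χ₂ n * χ₁.zetaMul n := by
  rw [zetaMul, mul_apply, mul_apply, Finset.mul_sum]
  refine Finset.sum_congr rfl fun x hx ↦ ?_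
  obtain ⟨hx, hn⟩ := Nat.mem_divisorsAntidiagonal.mp hx
  have h1 : x.1 ≠ 0 := by rintro h; simp [h] at hx; exact hn hx.symm
  have h2 : x.2 ≠ 0 := by rintro h; simp [h] at hx; exact hn hx.symm
  rw [← apply_eq_toArithmeticFunction_apply _ h1, ← apply_eq_toArithmeticFunction_apply _ h2,
    ← apply_eq_toArithmeticFunction_apply _ h2, hψ, ← hx, natCoe_apply, zeta_apply_ne h1]
  push_cast
  rw [map_mul]
  ring

lemma zetaMul_mul_prime_pow_nonneg {χ₁ : DirichletCharacter ℂ q₁}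
    {χ₂ : DirichletCharacter ℂ q₂} {ψ : DirichletCharacter ℂ q₃}
    (hψ : ∀ n : ℕ, ψ n = χ₁ n * χ₂ n) (h₁ : χ₁ ^ 2 = 1) {p : ℕ} (hp : p.Prime)
    (hχ : ∀ j : ℕ, 0 ≤ χ₂ (p ^ j : ℕ) * χ₁.zetaMul (p ^ j)) (k : ℕ) :
    0 ≤ (χ₁.zetaMul * (toArithmeticFunction (χ₂ ·) * toArithmeticFunction (ψ ·))) (p ^ k) := by
  rw [mul_apply]
  refine Finset.sum_nonneg fun x hx ↦ ?_
  obtain ⟨hx, -⟩ := Nat.mem_divisorsAntidiagonal.mp hx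
  obtain ⟨j, -, hj⟩ := (Nat.dvd_prime_pow hp).mp (Dvd.intro_left _ hx)
  rw [toArithmeticFunction_mul_apply_eq hψ, hj]
  exact mul_nonneg (zetaMul_nonneg h₁ _) (hχ j)

lemma zetaMul_mul_nonneg {χ₁ : DirichletCharacter ℂ q₁}
    {χ₂ : DirichletCharacter ℂ q₂} {ψ : DirichletCharacter ℂ q₃}
    (hψ : ∀ n : ℕ, ψ n = χ₁ n * χ₂ n) (h₁ : χ₁ ^ 2 = 1) (h₂ : χ₂ ^ 2 = 1) (n : ℕ) :
    0 ≤ (χ₁.zetaMul * (toArithmeticFunction (χ₂ ·) * toArithmeticFunction (ψ ·))) n := by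
  have hcomm : χ₁.zetaMul * (toArithmeticFunction (χ₂ ·) * toArithmeticFunction (ψ ·)) =
      χ₂.zetaMul * (toArithmeticFunction (χ₁ ·) * toArithmeticFunction (ψ ·)) := by
    simp only [zetaMul]; ring
  have hmul : (χ₁.zetaMul *
      (toArithmeticFunction (χ₂ ·) * toArithmeticFunction (ψ ·))).IsMultiplicative :=
    χ₁.isMultiplicative_zetaMul.mul
      (χ₂.isMultiplicative_toArithmeticFunction.mul ψ.isMultiplicative_toArithmeticFunction)
  rcases eq_or_ne n 0 with rfl | hn
  · simp
  rw [hmul.multiplicative_factorization _ hn]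
  refine Finset.prod_nonneg fun p hp ↦ ?_
  have hp := Nat.prime_of_mem_primeFactors hp
  have key {q : ℕ} {χ : DirichletCharacter ℂ q} (h : χ p = 0 ∨ χ p = 1) (j : ℕ) :
      0 ≤ χ (p ^ j : ℕ) := by
    rw [Nat.cast_pow, map_pow]
    rcases h with h | h <;> simp only [h, one_pow, zero_le_one, le_refl, pow_nonneg]
  rcases MulChar.isQuadratic_iff_sq_eq_one.mpr h₂ p with hv | hv | hv
  · exact zetaMul_mul_prime_pow_nonneg hψ h₁ hp
      (fun j ↦ mul_nonneg (key (.inl hv) j) (zetaMul_nonneg h₁ _)) _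
  · exact zetaMul_mul_prime_pow_nonneg hψ h₁ hp
      (fun j ↦ mul_nonneg (key (.inr hv) j) (zetaMul_nonneg h₁ _)) _
  have hψ' (n : ℕ) : ψ n = χ₂ n * χ₁ n := by rw [hψ, mul_comm]
  rcases MulChar.isQuadratic_iff_sq_eq_one.mpr h₁ p with hu | hu | hu
  · rw [hcomm]
    exact zetaMul_mul_prime_pow_nonneg hψ' h₂ hp
      (fun j ↦ mul_nonneg (key (.inl hu) j) (zetaMul_nonneg h₂ _)) _
  · rw [hcomm]
    exact zetaMul_mul_prime_pow_nonneg hψ' h₂ hp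
      (fun j ↦ mul_nonneg (key (.inr hu) j) (zetaMul_nonneg h₂ _)) _
  refine zetaMul_mul_prime_pow_nonneg hψ h₁ hp (fun j ↦ ?_) _
  rcases Nat.even_or_odd j with hj | hj
  · rw [Nat.cast_pow, map_pow, hv, hj.neg_one_pow, one_mul]
    exact zetaMul_nonneg h₁ _
  · have : χ₁.zetaMul (p ^ j) = 0 := by
      rw [zetaMul, coe_zeta_mul_apply, Nat.sum_divisors_prime_pow hp]
      have h (i : ℕ) : toArithmeticFunction (χ₁ ·) (p ^ i) = (-1) ^ i := by
        rw [← apply_eq_toArithmeticFunction_apply _ (pow_ne_zero _ hp.ne_zero), Nat.cast_pow,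
          map_pow, hu]
      simp only [h, neg_one_geom_sum]
      rw [if_pos (by grind)]
    rw [this, mul_zero]

lemma changeLevel_mul_changeLevel_natCast (χ₁ : DirichletCharacter ℂ q₁)
    (χ₂ : DirichletCharacter ℂ q₂) (n : ℕ) :
    (changeLevel (dvd_mul_right q₁ q₂) χ₁ * changeLevel (dvd_mul_left q₂ q₁) χ₂)
      (n : ZMod (q₁ * q₂)) = χ₁ n * χ₂ n := by
  rw [MulChar.mul_apply]
  by_cases h : IsUnit (n : ZMod (q₁ * q₂))
  · have h₁ := changeLevel_eq_cast_of_dvd χ₁ (dvd_mul_right q₁ q₂) h.unit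
    have h₂ := changeLevel_eq_cast_of_dvd χ₂ (dvd_mul_left q₂ q₁) h.unit
    rw [IsUnit.unit_spec, ZMod.cast_natCast (dvd_mul_right q₁ q₂)] at h₁
    rw [IsUnit.unit_spec, ZMod.cast_natCast (dvd_mul_left q₂ q₁)] at h₂
    rw [h₁, h₂]
  · rw [MulChar.map_nonunit _ h, zero_mul]
    rw [ZMod.isUnit_iff_coprime, Nat.coprime_mul_iff_right, not_and_or] at h
    rcases h with h | h
    · rw [χ₁.map_nonunit (by rwa [ZMod.isUnit_iff_coprime]), zero_mul]
    · rw [χ₂.map_nonunit (by rwa [ZMod.isUnit_iff_coprime]), mul_zero]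

lemma triple_mul_zeta_eq (χ₁ : DirichletCharacter ℂ q₁) (χ₂ : DirichletCharacter ℂ q₂)
    (ψ : DirichletCharacter ℂ q₃) :
    toArithmeticFunction (χ₁ ·) * (toArithmeticFunction (χ₂ ·) * toArithmeticFunction (ψ ·)) *
        (ArithmeticFunction.zeta : ArithmeticFunction ℂ) =
      χ₁.zetaMul * (toArithmeticFunction (χ₂ ·) * toArithmeticFunction (ψ ·)) := by
  rw [zetaMul]; ring

lemma triple_mul_zeta_re_nonneg {χ₁ : DirichletCharacter ℂ q₁}
    {χ₂ : DirichletCharacter ℂ q₂} {ψ : DirichletCharacter ℂ q₃}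
    (hψ : ∀ n : ℕ, ψ n = χ₁ n * χ₂ n) (h₁ : χ₁ ^ 2 = 1) (h₂ : χ₂ ^ 2 = 1) (n : ℕ) :
    0 ≤ ((toArithmeticFunction (χ₁ ·) *
      (toArithmeticFunction (χ₂ ·) * toArithmeticFunction (ψ ·)) *
        (ArithmeticFunction.zeta : ArithmeticFunction ℂ)) n).re := by
  rw [triple_mul_zeta_eq]
  exact (Complex.nonneg_iff.mp (zetaMul_mul_nonneg hψ h₁ h₂ n)).1

lemma triple_mul_zeta_one (χ₁ : DirichletCharacter ℂ q₁) (χ₂ : DirichletCharacter ℂ q₂)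
    (ψ : DirichletCharacter ℂ q₃) :
    (toArithmeticFunction (χ₁ ·) * (toArithmeticFunction (χ₂ ·) * toArithmeticFunction (ψ ·)) *
        (ArithmeticFunction.zeta : ArithmeticFunction ℂ)) 1 = 1 := by
  rw [triple_mul_zeta_eq]
  exact (χ₁.isMultiplicative_zetaMul.mul (χ₂.isMultiplicative_toArithmeticFunction.mul
    ψ.isMultiplicative_toArithmeticFunction)).1

end Positivity

section CharacterSums

open Finset

lemma sum_Ioc_add_level_eq_zero {q : ℕ} [NeZero q] {χ : DirichletCharacter ℂ q} (hχ : χ ≠ 1)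
    (m : ℕ) : ∑ n ∈ Ioc m (m + q), χ (n : ZMod q) = 0 := by
  have h1 : ∑ n ∈ Ioc m (m + q), χ (n : ZMod q) =
      ∑ k ∈ range q, χ ((m + 1 : ℕ) + (k : ℕ) : ZMod q) := by
    rw [← Finset.Ico_add_one_add_one_eq_Ioc, sum_Ico_eq_sum_range]
    refine sum_congr (by congr 1; omega) fun k _ ↦ by push_cast; rfl
  rw [h1, ← sum_zmod_val (fun k ↦ χ ((m + 1 : ℕ) + (k : ℕ) : ZMod q))]
  simp only [ZMod.natCast_zmod_val]
  exact (Fintype.sum_equiv (Equiv.addLeft ((m + 1 : ℕ) : ZMod q)) _ (fun x ↦ χ x)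
    fun _ ↦ rfl).trans (MulChar.sum_eq_zero_of_ne_one hχ)

lemma norm_sum_Ioc_le_level {q : ℕ} [NeZero q] {χ : DirichletCharacter ℂ q} (hχ : χ ≠ 1)
    (n : ℕ) : ‖∑ a ∈ Ioc 0 n, χ (a : ZMod q)‖ ≤ q := by
  induction n using Nat.strong_induction_on with
  | _ n ih =>
    rcases lt_or_ge n q with h | h
    · calc ‖∑ a ∈ Ioc 0 n, χ (a : ZMod q)‖ ≤ ∑ a ∈ Ioc 0 n, (1 : ℝ) :=
            norm_sum_le_of_le _ fun a _ ↦ χ.norm_le_one _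
        _ ≤ q := by simpa using h.le
    · obtain ⟨m, rfl⟩ := Nat.exists_eq_add_of_le' h
      rw [← sum_Ioc_consecutive _ (Nat.zero_le m) (Nat.le_add_right m q),
        sum_Ioc_add_level_eq_zero hχ, add_zero]
      exact ih m (by have := NeZero.pos q; omega)

lemma exists_filter_mod_eq_image {m r : ℕ} (hr : r < m) (N : ℕ) :
    ∃ K : ℕ, {k ∈ range N | k % m = r} = (range K).image (fun j ↦ r + m * j) := by
  refine ⟨(N + (m - 1 - r)) / m, ?_⟩
  ext k
  simp only [mem_filter, mem_range, mem_image]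
  constructor
  · rintro ⟨hk, rfl⟩
    refine ⟨k / m, ?_, Nat.mod_add_div k m⟩
    rw [Nat.lt_iff_add_one_le, Nat.le_div_iff_mul_le (by omega)]
    have := Nat.mod_add_div k m
    nlinarith [Nat.sub_add_cancel (show k % m ≤ m - 1 by omega),
      Nat.sub_add_cancel (show 1 ≤ m by omega)]
  · rintro ⟨j, hj, rfl⟩
    rw [Nat.lt_iff_add_one_le, Nat.le_div_iff_mul_le (by omega)] at hj
    refine ⟨?_, by rw [Nat.add_mul_mod_self_left, Nat.mod_eq_of_lt hr]⟩
    nlinarith [Nat.sub_add_cancel (show r ≤ m - 1 by omega),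
      Nat.sub_add_cancel (show 1 ≤ m by omega)]

lemma norm_sum_range_le_of_arithProg {f : ℕ → ℂ} {m : ℕ} (hm : 0 < m) {P : ℝ}
    (h : ∀ r < m, ∀ K, ‖∑ j ∈ range K, f (r + m * j)‖ ≤ P) (N : ℕ) :
    ‖∑ k ∈ range N, f k‖ ≤ m * P := by
  rw [← sum_fiberwise_of_maps_to (t := range m) (g := fun k ↦ k % m)
    (fun k _ ↦ mem_range.mpr (Nat.mod_lt k hm))]
  calc _ ≤ ∑ r ∈ range m, P := norm_sum_le_of_le _ fun r hr ↦ ?_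
    _ = m * P := by simp
  have hr := mem_range.mp hr
  obtain ⟨K, hK⟩ := exists_filter_mod_eq_image hr N
  rw [hK, sum_image fun a _ b _ hab ↦ by simpa [hm.ne'] using hab]
  exact h r hr K

/-- A Pólya–Vinogradov bound for the twist of a primitive quadratic character by a character
whose modulus it does not divide. -/
lemma norm_sum_Ioc_twist_le {q₁ q₂ : ℕ} [NeZero q₁] [NeZero q₂] (χ₁ : DirichletCharacter ℂ q₁)
    {χ₂ : DirichletCharacter ℂ q₂} (hprim : χ₂.IsPrimitive) (hχ : χ₂ ^ 2 = 1)
    (hq : ¬ q₂ ∣ q₁) (N : ℕ) :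
    ‖∑ n ∈ Ioc 0 N, χ₁ (n : ZMod q₁) * χ₂ (n : ZMod q₂)‖ ≤
      q₁ * (q₁ * (Real.sqrt q₂ * (1 + Real.log q₂))) := by
  rw [← Finset.Ico_add_one_add_one_eq_Ioc, sum_Ico_eq_sum_range]
  refine norm_sum_range_le_of_arithProg (NeZero.pos q₁) (fun r _ K ↦ ?_) _
  have h (j : ℕ) : χ₁ ((0 + 1 + (r + q₁ * j) : ℕ) : ZMod q₁) *
      χ₂ ((0 + 1 + (r + q₁ * j) : ℕ) : ZMod q₂) =
      χ₁ ((1 + r : ℕ) : ZMod q₁) * χ₂ ((1 + r + q₁ * j : ℕ) : ZMod q₂) := by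
    congr 2
    · push_cast; simp
    · push_cast; ring
  simp only [h, ← mul_sum, norm_mul]
  exact (mul_le_of_le_one_left (norm_nonneg _) (χ₁.norm_le_one _)).trans
    (norm_sum_arithProg_le hprim hχ hq _ _)

end CharacterSums

section RealValues

open Filter Topology

lemma exists_real_apply_eq {q : ℕ} {χ : DirichletCharacter ℂ q} (hχ : χ ^ 2 = 1) (a : ZMod q) :
    ∃ r : ℝ, χ a = r := by
  rcases MulChar.isQuadratic_iff_sq_eq_one.mpr hχ a with h | h | h
  · exact ⟨0, by simp [h]⟩
  · exact ⟨1, by simp [h]⟩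
  · exact ⟨-1, by simp [h]⟩

lemma LFunction_ofReal_im_eq_zero {q : ℕ} [NeZero q] {χ : DirichletCharacter ℂ q}
    (hχ : χ ^ 2 = 1) (hχ1 : χ ≠ 1) {σ : ℝ} (hσ : 0 < σ) : (LFunction χ σ).im = 0 := by
  have hle (M : ℕ) (hM : 1 ≤ M) : |(LFunction χ σ).im| ≤ 2 * q * (M : ℝ) ^ (-σ) := by
    have := norm_continuation_sub_sum_le (f := fun n ↦ χ n) (G := LFunction χ) (θ := 0)
      (B := q) le_rfl hM (fun n _ ↦ by
        rw [Real.rpow_zero, mul_one]; exact norm_sum_Ioc_le_level hχ1 n)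
      (fun s hs ↦ LSeriesSummable_of_one_lt_re χ hs) (fun s hs ↦ LFunction_eq_LSeries χ hs)
      (fun s _ ↦ (differentiable_LFunction hχ1).differentiableAt) hσ
    have hr : (∑ n ∈ Finset.Icc 1 M, χ n * (n : ℂ) ^ (-σ : ℂ)).im = 0 := by
      rw [Complex.im_sum]
      refine Finset.sum_eq_zero fun n _ ↦ ?_
      obtain ⟨r, hr⟩ := exists_real_apply_eq hχ n
      rw [natCast_cpow_neg_ofReal, hr, ← Complex.ofReal_mul, Complex.ofReal_im]
    have h2 := (Complex.abs_im_le_norm _).trans this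
    rw [Complex.sub_im, hr, sub_zero, sub_zero, div_self hσ.ne', zero_sub, mul_one] at h2
    exact h2
  have hlim : Tendsto (fun M : ℕ ↦ 2 * q * (M : ℝ) ^ (-σ)) atTop (𝓝 (2 * q * 0)) :=
    ((tendsto_rpow_neg_atTop hσ).comp tendsto_natCast_atTop_atTop).const_mul _
  rw [mul_zero] at hlim
  exact abs_nonpos_iff.mp (ge_of_tendsto hlim ((eventually_ge_atTop 1).mono hle))

/-- A nontrivial quadratic `L`-function without zeros on `[σ, 1)` is positive at `σ`. -/
lemma exists_pos_LFunction_ofReal_eq {q : ℕ} [NeZero q] {χ : DirichletCharacter ℂ q}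
    (hχ : χ ^ 2 = 1) (hχ1 : χ ≠ 1) {σ : ℝ} (hσ : 0 < σ)
    (h : ∀ t : ℝ, σ ≤ t → t < 1 → LFunction χ t ≠ 0) :
    ∃ r : ℝ, 0 < r ∧ LFunction χ σ = r := by
  have hreal (t : ℝ) (ht : σ ≤ t) : LFunction χ t = ((LFunction χ t).re : ℂ) :=
    Complex.ext (by simp) (by simp [LFunction_ofReal_im_eq_zero hχ hχ1 (hσ.trans_le ht)])
  refine ⟨_, ?_, hreal σ le_rfl⟩
  by_contra! hneg
  have hcont : Continuous fun t : ℝ ↦ (LFunction χ t).re :=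
    Complex.continuous_re.comp
      ((differentiable_LFunction hχ1).continuous.comp Complex.continuous_ofReal)
  have hlim : Tendsto (fun t : ℝ ↦ (LSeries (χ ·) t).re) atTop (𝓝 1) := by
    have := LSeries.tendsto_atTop (f := fun n ↦ χ n) (lt_of_le_of_lt
      (LSeries.abscissaOfAbsConv_le_of_le_const ⟨1, fun n _ ↦ χ.norm_le_one n⟩)
      (EReal.coe_lt_top 1))
    simpa [Function.comp_def] using (Complex.continuous_re.tendsto _).comp this
  obtain ⟨T, hT, hT1, hTσ⟩ := ((hlim.eventually (lt_mem_nhds one_pos)).and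
    ((eventually_gt_atTop 1).and (eventually_ge_atTop σ))).exists
  rw [← LFunction_eq_LSeries χ (by simpa using hT1)] at hT
  obtain ⟨t, ht, ht0⟩ := intermediate_value_Icc hTσ hcont.continuousOn ⟨hneg, hT.le⟩
  have h0 : LFunction χ t = 0 := by
    rw [hreal t ht.1]
    exact_mod_cast ht0
  rcases lt_or_ge t 1 with h1 | h1
  · exact h t ht.1 h1 h0
  · exact LFunction_ne_zero_of_one_le_re χ (.inl hχ1) (by simpa using h1) h0

lemma exists_pos_LFunction_one_eq_of_quadratic {q : ℕ} [NeZero q] {χ : DirichletCharacter ℂ q}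
    (hχ : χ ^ 2 = 1) (hχ1 : χ ≠ 1) : ∃ r : ℝ, 0 < r ∧ LFunction χ 1 = r := by
  simpa using exists_pos_LFunction_ofReal_eq hχ hχ1 one_pos fun t h1 h2 ↦ absurd h1 h2.not_ge

/-- If primitive quadratic `L`-functions do not vanish at a point, neither do imprimitive ones. -/
lemma LFunction_ofReal_ne_zero_of_primitive {t : ℝ} (ht : 0 < t)
    (h : ∀ (q : ℕ) [NeZero q] (χ : DirichletCharacter ℂ q), χ.IsPrimitive → χ ^ 2 = 1 → χ ≠ 1 →
      LFunction χ t ≠ 0) {q : ℕ} [NeZero q] {χ : DirichletCharacter ℂ q}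
    (hχ : χ ^ 2 = 1) (hχ1 : χ ≠ 1) : LFunction χ t ≠ 0 := by
  have : NeZero χ.conductor := ⟨fun h0 ↦ NeZero.ne q
    (conductor_eq_zero_iff_level_eq_zero.mp h0)⟩
  have hψ := χ.changeLevel_primitiveCharacter
  have hψ1 : χ.primitiveCharacter ≠ 1 := fun h1 ↦ hχ1 (by rw [← hψ, h1, changeLevel_one])
  have hψ2 : χ.primitiveCharacter ^ 2 = 1 := by
    refine changeLevel_injective χ.conductor_dvd_level ?_
    rw [map_pow, hψ, hχ, changeLevel_one]
  rw [← hψ, LFunction_changeLevel _ _ (.inl hψ1)]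
  refine mul_ne_zero (h _ _ χ.primitiveCharacter_isPrimitive hψ2 hψ1)
    (Finset.prod_ne_zero_iff.mpr fun p hp h0 ↦ ?_)
  have hp2 := (Nat.prime_of_mem_primeFactors hp).two_le
  have h1 : ‖χ.primitiveCharacter p * (p : ℂ) ^ (-t : ℂ)‖ = 1 := by
    rw [← sub_eq_zero.mp h0, norm_one]
  rw [norm_mul, natCast_cpow_neg_ofReal, Complex.norm_real, Real.norm_of_nonneg (by positivity)]
    at h1
  have h2 := mul_le_of_le_one_left (Real.rpow_nonneg (Nat.cast_nonneg p) (-t))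
    (χ.primitiveCharacter.norm_le_one p)
  have h3 := Real.rpow_lt_one_of_one_lt_of_neg (x := (p : ℝ)) (by exact_mod_cast hp2)
    (neg_neg_of_pos ht)
  linarith

end RealValues

section QuadraticTwists

variable {q₁ q₂ : ℕ}

lemma exists_isPrimitive_quadratic : ∃ χ : DirichletCharacter ℂ 3,
    χ.IsPrimitive ∧ χ ^ 2 = 1 ∧ χ ≠ 1 := by
  have : Fact (Nat.Prime 3) := ⟨Nat.prime_three⟩
  let χ : DirichletCharacter ℂ 3 := (quadraticChar (ZMod 3)).ringHomComp (Int.castRingHom ℂ)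
  have hχ1 : χ ≠ 1 := (MulChar.ringHomComp_ne_one_iff Int.cast_injective).mpr
    (quadraticChar_ne_one (by rw [ZMod.ringChar_zmod_n]; norm_num))
  refine ⟨χ, ?_, MulChar.isQuadratic_iff_sq_eq_one.mp
    ((quadraticChar_isQuadratic (ZMod 3)).comp _), hχ1⟩
  rcases (Nat.dvd_prime Nat.prime_three).mp χ.conductor_dvd_level with h | h
  · exact absurd (χ.eq_one_iff_conductor_eq_one.mpr h) hχ1
  · exact h

/-- Some primitive quadratic character has, arbitrarily close to `1`, either a zero of its
`L`-function or a point where all products of three quadratic `L`-functions are nonnegative. -/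
lemma exists_isPrimitive_forall_LFunction_mul_re_nonneg {b : ℝ} (hb : 0 < b) (hb1 : b < 1) :
    ∃ (q₁ : ℕ) (_ : NeZero q₁) (χ₁ : DirichletCharacter ℂ q₁) (β : ℝ),
      χ₁.IsPrimitive ∧ χ₁ ^ 2 = 1 ∧ χ₁ ≠ 1 ∧ b < β ∧ β < 1 ∧
      ∀ {q₂ q₃ : ℕ} [NeZero q₂] [NeZero q₃] (χ₂ : DirichletCharacter ℂ q₂)
        (ψ : DirichletCharacter ℂ q₃), χ₂ ^ 2 = 1 → χ₂ ≠ 1 → ψ ^ 2 = 1 → ψ ≠ 1 →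
        0 ≤ (LFunction χ₁ β * (LFunction χ₂ β * LFunction ψ β)).re := by
  by_cases H : ∃ (q₁ : ℕ) (_ : NeZero q₁) (χ₁ : DirichletCharacter ℂ q₁) (β : ℝ),
      χ₁.IsPrimitive ∧ χ₁ ^ 2 = 1 ∧ χ₁ ≠ 1 ∧ b < β ∧ β < 1 ∧ LFunction χ₁ β = 0
  · obtain ⟨q₁, h₁, χ₁, β, hp, hs, hn, hbβ, hβ, h0⟩ := H
    exact ⟨q₁, h₁, χ₁, β, hp, hs, hn, hbβ, hβ, fun χ₂ ψ _ _ _ _ ↦ by simp [h0]⟩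
  · push Not at H
    obtain ⟨χ₁, hp, hs, hn⟩ := exists_isPrimitive_quadratic
    obtain ⟨β, hbβ, hβ⟩ := exists_between hb1
    have key {q : ℕ} [NeZero q] {χ : DirichletCharacter ℂ q} (hχ : χ ^ 2 = 1) (hχ1 : χ ≠ 1) :
        ∃ r : ℝ, 0 < r ∧ LFunction χ β = r :=
      exists_pos_LFunction_ofReal_eq hχ hχ1 (hb.trans hbβ) fun t ht ht1 ↦
        LFunction_ofReal_ne_zero_of_primitive (hb.trans (hbβ.trans_le ht))
          (fun q hq χ h1 h2 h3 ↦ H q hq χ t h1 h2 h3 (hbβ.trans_le ht) ht1) hχ hχ1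
    refine ⟨3, ⟨by norm_num⟩, χ₁, β, hp, hs, hn, hbβ, hβ, fun χ₂ ψ h2 h2' h3 h3' ↦ ?_⟩
    obtain ⟨r₁, hr₁, e₁⟩ := key hs hn
    obtain ⟨r₂, hr₂, e₂⟩ := key h2 h2'
    obtain ⟨r₃, hr₃, e₃⟩ := key h3 h3'
    rw [e₁, e₂, e₃, ← Complex.ofReal_mul, ← Complex.ofReal_mul, Complex.ofReal_re]
    positivity

/-- The product character `χ₁χ₂` modulo `q₁q₂`. -/
noncomputable def productChar (χ₁ : DirichletCharacter ℂ q₁) (χ₂ : DirichletCharacter ℂ q₂) :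
    DirichletCharacter ℂ (q₁ * q₂) :=
  changeLevel (dvd_mul_right q₁ q₂) χ₁ * changeLevel (dvd_mul_left q₂ q₁) χ₂

lemma productChar_sq {χ₁ : DirichletCharacter ℂ q₁} {χ₂ : DirichletCharacter ℂ q₂}
    (h₁ : χ₁ ^ 2 = 1) (h₂ : χ₂ ^ 2 = 1) : productChar χ₁ χ₂ ^ 2 = 1 := by
  rw [productChar, mul_pow, ← map_pow, ← map_pow, h₁, h₂, map_one, map_one, mul_one]

lemma productChar_ne_one [NeZero q₁] [NeZero q₂] {χ₁ : DirichletCharacter ℂ q₁}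
    {χ₂ : DirichletCharacter ℂ q₂} (hp₁ : χ₁.IsPrimitive) (hp₂ : χ₂.IsPrimitive)
    (h₂ : χ₂ ^ 2 = 1) (hq : q₁ ≠ q₂) : productChar χ₁ χ₂ ≠ 1 := by
  intro h
  have h' : changeLevel (dvd_mul_right q₁ q₂) χ₁ = changeLevel (dvd_mul_left q₂ q₁) χ₂ := by
    rw [eq_inv_of_mul_eq_one_left h, ← map_inv, inv_eq_self_of_sq_eq_one h₂]
  have h'' := congrArg conductor h'
  rw [conductor_changeLevel, conductor_changeLevel] at h''
  exact hq (hp₁.symm.trans (h''.trans hp₂))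

lemma exists_pos_LFunction_one_mul_eq [NeZero q₁] [NeZero q₂] {χ₁ : DirichletCharacter ℂ q₁}
    {χ₂ : DirichletCharacter ℂ q₂} (h₁ : χ₁ ^ 2 = 1) (hn₁ : χ₁ ≠ 1) (h₂ : χ₂ ^ 2 = 1)
    (hn₂ : χ₂ ≠ 1) : ∃ r : ℝ, 0 < r ∧
      LFunction χ₁ 1 * LFunction χ₂ 1 * LFunction (productChar χ₁ χ₂) 1 = r := by
  obtain ⟨r₁, hr₁, e₁⟩ := exists_pos_LFunction_one_eq_of_quadratic h₁ hn₁
  obtain ⟨r₂, hr₂, e₂⟩ := exists_pos_LFunction_one_eq_of_quadratic h₂ hn₂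
  obtain ⟨r₃, hr₃, e₃⟩ : ∃ r : ℝ, 0 < r ∧ LFunction (productChar χ₁ χ₂) 1 = r := by
    by_cases h : productChar χ₁ χ₂ = 1
    · rw [h]
      refine exists_pos_LFunction_one_eq fun hq ↦ hn₁ (level_one' _ ?_)
      exact Nat.eq_one_of_mul_eq_one_right hq
    · exact exists_pos_LFunction_one_eq_of_quadratic (productChar_sq h₁ h₂) h
  exact ⟨r₁ * r₂ * r₃, by positivity, by rw [e₁, e₂, e₃]; push_cast; rfl⟩

/-- A uniform lower bound for the residue over all `χ₂` of bounded modulus. -/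
lemma exists_forall_one_le_mul_LFunction_one [NeZero q₁] {χ₁ : DirichletCharacter ℂ q₁}
    (h₁ : χ₁ ^ 2 = 1) (hn₁ : χ₁ ≠ 1) (Q : ℕ) :
    ∃ C : ℝ, 0 < C ∧ ∀ (q₂ : ℕ) [NeZero q₂] (χ₂ : DirichletCharacter ℂ q₂), q₂ < Q →
      χ₂ ^ 2 = 1 → χ₂ ≠ 1 → 1 ≤ C *
        (LFunction χ₁ 1 * LFunction χ₂ 1 * LFunction (productChar χ₁ χ₂) 1).re := by
  induction Q with
  | zero => exact ⟨1, one_pos, fun q₂ _ _ h ↦ by omega⟩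
  | succ Q ih =>
    obtain ⟨C, hC, ih⟩ := ih
    rcases Nat.eq_zero_or_pos Q with rfl | hQ
    · exact ⟨1, one_pos, fun q₂ _ _ h ↦ absurd (NeZero.ne q₂) (by omega)⟩
    have : NeZero Q := ⟨hQ.ne'⟩
    let f (χ₂ : DirichletCharacter ℂ Q) : ℝ :=
      (LFunction χ₁ 1 * LFunction χ₂ 1 * LFunction (productChar χ₁ χ₂) 1).re
    obtain ⟨K, hK⟩ := Finite.exists_le fun χ₂ ↦ (f χ₂)⁻¹
    refine ⟨max C K, lt_max_of_lt_left hC, fun q₂ _ χ₂ hq h₂ hn₂ ↦ ?_⟩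
    obtain ⟨r, hr, e⟩ := exists_pos_LFunction_one_mul_eq h₁ hn₁ h₂ hn₂
    rcases Nat.lt_succ_iff_lt_or_eq.mp hq with hq | rfl
    · have h := ih q₂ χ₂ hq h₂ hn₂
      rw [e, Complex.ofReal_re] at h ⊢
      exact h.trans (mul_le_mul_of_nonneg_right (le_max_left _ _) hr.le)
    · have h := hK χ₂
      simp only [f] at h
      rw [e, Complex.ofReal_re] at h ⊢
      calc (1 : ℝ) = r⁻¹ * r := (inv_mul_cancel₀ hr.ne').symm
        _ ≤ _ := mul_le_mul_of_nonneg_right (h.trans (le_max_right _ _)) hr.le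

end QuadraticTwists

section TripleConvolution

open Finset

variable {q₁ q₂ : ℕ}

/-- The Dirichlet coefficients of `L(s, χ₁) L(s, χ₂) L(s, χ₁χ₂)`. -/
noncomputable def tripleConv (χ₁ : DirichletCharacter ℂ q₁) (χ₂ : DirichletCharacter ℂ q₂) :
    ArithmeticFunction ℂ :=
  toArithmeticFunction (χ₁ ·) *
    (toArithmeticFunction (χ₂ ·) * toArithmeticFunction (productChar χ₁ χ₂ ·))

lemma norm_toArithmeticFunction_le_one (χ : DirichletCharacter ℂ q₁) (n : ℕ) :
    ‖toArithmeticFunction (χ ·) n‖ ≤ 1 := by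
  rcases eq_or_ne n 0 with rfl | hn
  · simp
  · rw [← apply_eq_toArithmeticFunction_apply χ hn]
    exact χ.norm_le_one _

lemma sum_Ioc_toArithmeticFunction (χ : DirichletCharacter ℂ q₁) (n : ℕ) :
    ∑ a ∈ Ioc 0 n, toArithmeticFunction (χ ·) a = ∑ a ∈ Ioc 0 n, χ a :=
  sum_congr rfl fun _ ha ↦
    (apply_eq_toArithmeticFunction_apply χ (mem_Ioc.mp ha).1.ne').symm

lemma LSeriesSummable_toArithmeticFunction (χ : DirichletCharacter ℂ q₁) {s : ℂ} (hs : 1 < s.re) :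
    LSeriesSummable (toArithmeticFunction (χ ·) ·) s :=
  (LSeriesSummable_congr _ fun {_} hn ↦ (apply_eq_toArithmeticFunction_apply χ hn)).mp
    (LSeriesSummable_of_one_lt_re χ hs)

lemma LSeries_toArithmeticFunction [NeZero q₁] (χ : DirichletCharacter ℂ q₁) {s : ℂ}
    (hs : 1 < s.re) : LSeries (toArithmeticFunction (χ ·) ·) s = LFunction χ s := by
  rw [LFunction_eq_LSeries χ hs]
  exact (LSeries_congr (fun {_} hn ↦ apply_eq_toArithmeticFunction_apply χ hn) s).symm

lemma LSeriesSummable_tripleConv (χ₁ : DirichletCharacter ℂ q₁) (χ₂ : DirichletCharacter ℂ q₂)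
    {s : ℂ} (hs : 1 < s.re) : LSeriesSummable (tripleConv χ₁ χ₂ ·) s :=
  ArithmeticFunction.LSeriesSummable_mul (LSeriesSummable_toArithmeticFunction _ hs)
    (ArithmeticFunction.LSeriesSummable_mul (LSeriesSummable_toArithmeticFunction _ hs)
      (LSeriesSummable_toArithmeticFunction _ hs))

lemma LSeries_tripleConv [NeZero q₁] [NeZero q₂] (χ₁ : DirichletCharacter ℂ q₁)
    (χ₂ : DirichletCharacter ℂ q₂) {s : ℂ} (hs : 1 < s.re) :
    LSeries (tripleConv χ₁ χ₂ ·) s =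
      LFunction χ₁ s * (LFunction χ₂ s * LFunction (productChar χ₁ χ₂) s) := by
  rw [← LSeries_toArithmeticFunction χ₁ hs, ← LSeries_toArithmeticFunction χ₂ hs,
    ← LSeries_toArithmeticFunction (productChar χ₁ χ₂) hs]
  rw [tripleConv, ArithmeticFunction.LSeries_mul' (LSeriesSummable_toArithmeticFunction _ hs)
    (ArithmeticFunction.LSeriesSummable_mul (LSeriesSummable_toArithmeticFunction _ hs)
      (LSeriesSummable_toArithmeticFunction _ hs)),
    ArithmeticFunction.LSeries_mul' (LSeriesSummable_toArithmeticFunction _ hs)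
      (LSeriesSummable_toArithmeticFunction _ hs)]

lemma sum_Ioc_norm_tripleConv_le {η : ℝ} (hη : 0 < η) (χ₁ : DirichletCharacter ℂ q₁)
    (χ₂ : DirichletCharacter ℂ q₂) (M : ℕ) :
    ∑ m ∈ Ioc 0 M, ‖tripleConv χ₁ χ₂ m‖ ≤
      (∑' n : ℕ, 1 / (n : ℝ) ^ (1 + η)) ^ 2 * (M : ℝ) ^ (1 + η) := by
  have h₁ (n : ℕ) : ∑ a ∈ Ioc 0 n, ‖toArithmeticFunction (productChar χ₁ χ₂ ·) a‖ ≤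
      1 * (n : ℝ) ^ (1 + η) := by
    calc _ ≤ ∑ a ∈ Ioc 0 n, (1 : ℝ) := sum_le_sum fun a _ ↦ norm_toArithmeticFunction_le_one _ a
      _ = n := by simp
      _ ≤ 1 * (n : ℝ) ^ (1 + η) := by
        rcases Nat.eq_zero_or_pos n with rfl | hn
        · rw [one_mul]; exact_mod_cast Real.rpow_nonneg le_rfl _
        · rw [one_mul]
          exact Real.self_le_rpow_of_one_le (by exact_mod_cast hn) (by linarith)
  have h := sum_Ioc_norm_mul_le hη (norm_toArithmeticFunction_le_one χ₁)
    (sum_Ioc_norm_mul_le hη (norm_toArithmeticFunction_le_one χ₂) h₁) M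
  rw [one_mul, ← sq] at h
  exact h

lemma one_add_log_le {η x : ℝ} (hη : 0 < η) (hx : 1 ≤ x) :
    1 + Real.log x ≤ (1 + 1 / η) * x ^ η := by
  have h1 := Real.log_le_rpow_div (zero_le_one.trans hx) hη
  have h2 := Real.one_le_rpow hx hη.le
  calc _ ≤ x ^ η + x ^ η / η := add_le_add h2 h1
    _ = _ := by ring

/-- Square-root cancellation for `tripleConv` beyond the modulus of `χ₂`. -/
lemma exists_norm_sum_Ioc_tripleConv_le [NeZero q₁] {χ₁ : DirichletCharacter ℂ q₁}
    (hn₁ : χ₁ ≠ 1) {η : ℝ} (hη : 0 < η) (hη1 : η ≤ 1 / 32) :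
    ∃ B : ℝ, 0 < B ∧ ∀ (q₂ : ℕ) [NeZero q₂] (χ₂ : DirichletCharacter ℂ q₂), q₁ < q₂ →
      χ₂.IsPrimitive → χ₂ ^ 2 = 1 → ∀ n : ℕ, (q₂ : ℝ) ^ (1 + 8 * η) ≤ n →
        ‖∑ m ∈ Ioc 0 n, tripleConv χ₁ χ₂ m‖ ≤ B * (n : ℝ) ^ (1 - η ^ 2) := by
  set Z := ∑' n : ℕ, 1 / (n : ℝ) ^ (1 + η)
  have hZ : 0 ≤ Z := tsum_nonneg fun n ↦ by positivity
  have hq₁ : (1 : ℝ) ≤ q₁ := by exact_mod_cast NeZero.pos q₁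
  refine ⟨14 * (q₁ * (q₁ * (1 + 1 / η))) + 2 * q₁ * Z, by positivity,
    fun q₂ _ χ₂ hq hp₂ h₂ n hn ↦ ?_⟩
  have hq₂ : (1 : ℝ) ≤ q₂ := by exact_mod_cast NeZero.pos q₂
  have hn1 : (1 : ℝ) ≤ n := (Real.one_le_rpow hq₂ (by positivity)).trans hn
  set S := Real.sqrt q₂ * (1 + Real.log q₂) with hS
  have hS0 : 0 ≤ S := mul_nonneg (Real.sqrt_nonneg _) (by linarith [Real.log_nonneg hq₂])
  have hSle : S ≤ (1 + 1 / η) * (n : ℝ) ^ (1 / 2 - η - η ^ 2) := by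
    calc S ≤ (q₂ : ℝ) ^ (1 / 2 : ℝ) * ((1 + 1 / η) * (q₂ : ℝ) ^ η) := by
          rw [hS, Real.sqrt_eq_rpow]
          exact mul_le_mul_of_nonneg_left (one_add_log_le hη hq₂) (by positivity)
      _ = (1 + 1 / η) * (q₂ : ℝ) ^ (1 / 2 + η) := by
          rw [Real.rpow_add (by positivity)]; ring
      _ ≤ (1 + 1 / η) * (q₂ : ℝ) ^ ((1 + 8 * η) * (1 / 2 - η - η ^ 2)) := by
          gcongr
          nlinarith [mul_nonneg hη.le (sub_nonneg.mpr hη1), mul_pos hη hη,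
            mul_nonneg (mul_pos hη hη).le (sub_nonneg.mpr hη1)]
      _ ≤ _ := by
          rw [Real.rpow_mul (by positivity)]
          gcongr
          nlinarith
  have hA (m : ℕ) : ‖∑ a ∈ Ioc 0 m, toArithmeticFunction (χ₁ ·) a‖ ≤ q₁ := by
    rw [sum_Ioc_toArithmeticFunction]
    exact norm_sum_Ioc_le_level hn₁ m
  have hP₂ (m : ℕ) : ‖∑ a ∈ Ioc 0 m, toArithmeticFunction (χ₂ ·) a‖ ≤ q₁ * (q₁ * S) := by
    rw [sum_Ioc_toArithmeticFunction]
    have h := norm_sum_Ioc_twist_le (1 : DirichletCharacter ℂ 1) hp₂ h₂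
      (by rw [Nat.dvd_one]; have := NeZero.pos q₁; omega) m
    simp only [Nat.cast_one, one_mul, MulChar.one_apply (isUnit_of_subsingleton _)] at h
    exact h.trans (by nlinarith [mul_le_mul_of_nonneg_right hq₁ hS0])
  have hP₃ (m : ℕ) :
      ‖∑ a ∈ Ioc 0 m, toArithmeticFunction (productChar χ₁ χ₂ ·) a‖ ≤ q₁ * (q₁ * S) := by
    rw [sum_Ioc_toArithmeticFunction]
    simp only [productChar, changeLevel_mul_changeLevel_natCast]
    exact norm_sum_Ioc_twist_le χ₁ hp₂ h₂
      (fun h ↦ (Nat.le_of_dvd (NeZero.pos q₁) h).not_gt hq) m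
  have h := norm_sum_Ioc_triple_mul_le hη (hη1.trans (by norm_num))
    (norm_toArithmeticFunction_le_one χ₁) (norm_toArithmeticFunction_le_one χ₂)
    (norm_toArithmeticFunction_le_one (productChar χ₁ χ₂)) hA hP₂ hP₃
    (N := n) (by exact_mod_cast hn1)
  refine h.trans ?_
  rw [add_mul]
  gcongr ?_ + ?_
  · calc 14 * (q₁ * (q₁ * S)) * (n : ℝ) ^ (1 / 2 + η)
        ≤ 14 * (q₁ * (q₁ * ((1 + 1 / η) * (n : ℝ) ^ (1 / 2 - η - η ^ 2)))) *
            (n : ℝ) ^ (1 / 2 + η) := by gcongr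
      _ = 14 * (q₁ * (q₁ * (1 + 1 / η))) *
            ((n : ℝ) ^ (1 / 2 - η - η ^ 2) * (n : ℝ) ^ (1 / 2 + η)) := by ring
      _ = _ := by rw [← Real.rpow_add (by positivity)]; ring_nf
  · exact le_rfl

end TripleConvolution

section Assembly

open Finset

lemma natCeil_rpow_bounds {x a : ℝ} (hx : 1 ≤ x) (ha : 0 ≤ a) :
    0 < ⌈x ^ a⌉₊ ∧ x ^ a ≤ ⌈x ^ a⌉₊ ∧ (⌈x ^ a⌉₊ : ℝ) ≤ 2 * x ^ a := by
  have h := Real.one_le_rpow hx ha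
  refine ⟨Nat.ceil_pos.mpr (by linarith), Nat.le_ceil _, ?_⟩
  linarith [Nat.ceil_lt_add_one (zero_le_one.trans h)]

lemma rpow_natCeil_le {x a s : ℝ} (hx : 1 ≤ x) (ha : 0 ≤ a) (hs : 0 ≤ s) (hs2 : s ≤ 2) :
    (⌈x ^ a⌉₊ : ℝ) ^ s ≤ 4 * x ^ (a * s) := by
  obtain ⟨-, -, h⟩ := natCeil_rpow_bounds hx ha
  calc (⌈x ^ a⌉₊ : ℝ) ^ s ≤ (2 * x ^ a) ^ s := by gcongr
    _ = 2 ^ s * x ^ (a * s) := by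
      rw [Real.mul_rpow (by norm_num) (by positivity), ← Real.rpow_mul (by positivity)]
    _ ≤ 2 ^ (2 : ℝ) * x ^ (a * s) := by
      gcongr
      norm_num
    _ = 4 * x ^ (a * s) := by norm_num

lemma rpow_natCeil_le_of_nonpos {x a s : ℝ} (hx : 1 ≤ x) (hs : s ≤ 0) :
    (⌈x ^ a⌉₊ : ℝ) ^ s ≤ x ^ (a * s) := by
  rw [Real.rpow_mul (by positivity)]
  exact Real.rpow_le_rpow_of_nonpos (by positivity) (Nat.le_ceil _) hs

lemma error_terms_le {η β q : ℝ} (hη : 0 < η) (hη1 : η ≤ 1 / 32) (hβ : 1 - η ^ 2 / 2 < β)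
    (hβ1 : β < 1) (hq : 1 ≤ q) {M N : ℕ} (hM : M = ⌈q ^ (1 + 8 * η)⌉₊)
    (hN : N = ⌈q ^ (1 + 16 * η)⌉₊) {B Z : ℝ} (hB : 0 ≤ B) (hZ : 0 ≤ Z) :
    B * ((N : ℝ) ^ (1 - β) * (M : ℝ) ^ (1 - η ^ 2 - 1) +
        (M : ℝ) ^ (1 - η ^ 2 - β) * ((N : ℝ) / M) ^ (1 - β)) +
      Z * (M : ℝ) ^ (1 + η) * (N : ℝ) ^ (-β) ≤ (8 * B + 4 * Z) * q ^ (-(η ^ 2 / 2)) := by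
  have hq0 : 0 < q := by linarith
  have hM0 : 0 < (M : ℝ) := by
    rw [hM]; exact_mod_cast (natCeil_rpow_bounds hq (by positivity)).1
  have h₁ : (N : ℝ) ^ (1 - β) * (M : ℝ) ^ (1 - η ^ 2 - 1) ≤ 4 * q ^ (-(η ^ 2 / 2)) := by
    calc (N : ℝ) ^ (1 - β) * (M : ℝ) ^ (1 - η ^ 2 - 1)
        ≤ (4 * q ^ ((1 + 16 * η) * (1 - β))) * q ^ ((1 + 8 * η) * (1 - η ^ 2 - 1)) := by
          rw [hM, hN]
          gcongr
          · exact rpow_natCeil_le hq (by positivity) (by linarith) (by nlinarith)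
          · exact rpow_natCeil_le_of_nonpos hq (by nlinarith)
      _ = 4 * q ^ ((1 + 16 * η) * (1 - β) + (1 + 8 * η) * (1 - η ^ 2 - 1)) := by
          rw [mul_assoc, ← Real.rpow_add hq0]
      _ ≤ 4 * q ^ (-(η ^ 2 / 2)) := by
          gcongr
          nlinarith [mul_pos hη (sub_pos.mpr hβ)]
  have h₂ : (M : ℝ) ^ (1 - η ^ 2 - β) * ((N : ℝ) / M) ^ (1 - β) =
      (N : ℝ) ^ (1 - β) * (M : ℝ) ^ (1 - η ^ 2 - 1) := by
    rw [Real.div_rpow (by positivity) (by positivity), mul_div_assoc', mul_comm, mul_div_assoc,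
      ← Real.rpow_sub hM0]
    ring_nf
  have h₃ : (M : ℝ) ^ (1 + η) * (N : ℝ) ^ (-β) ≤ 4 * q ^ (-(η ^ 2 / 2)) := by
    calc (M : ℝ) ^ (1 + η) * (N : ℝ) ^ (-β)
        ≤ (4 * q ^ ((1 + 8 * η) * (1 + η))) * q ^ ((1 + 16 * η) * (-β)) := by
          rw [hM, hN]
          gcongr
          · exact rpow_natCeil_le hq (by positivity) (by linarith) (by linarith)
          · exact rpow_natCeil_le_of_nonpos hq (by nlinarith)
      _ = 4 * q ^ ((1 + 8 * η) * (1 + η) + (1 + 16 * η) * (-β)) := by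
          rw [mul_assoc, ← Real.rpow_add hq0]
      _ ≤ 4 * q ^ (-(η ^ 2 / 2)) := by
          gcongr
          nlinarith [mul_pos hη (sub_pos.mpr hβ), mul_nonneg hη.le (sub_nonneg.mpr hη1),
            mul_nonneg (mul_pos hη hη).le (sub_nonneg.mpr hη1)]
  rw [h₂, mul_assoc Z]
  nlinarith [mul_le_mul_of_nonneg_left h₁ hB, mul_le_mul_of_nonneg_left h₃ hZ]

lemma exists_forall_mul_rpow_neg_le (E : ℝ) {c : ℝ} (hc : 0 < c) :
    ∃ Q : ℕ, ∀ q : ℕ, Q ≤ q → E * (q : ℝ) ^ (-c) ≤ 1 / 2 := by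
  have h := ((tendsto_rpow_neg_atTop hc).comp tendsto_natCast_atTop_atTop).const_mul E
  rw [mul_zero] at h
  exact Filter.eventually_atTop.mp (h.eventually_le_const (by norm_num))

/-- The inequality at the single point `x = q₂ ^ (1 + 16η)`, for all large `q₂`. -/
lemma exists_forall_one_le_mul_rpow {η : ℝ} (hη : 0 < η) (hη1 : η ≤ 1 / 32) {q₁ : ℕ} [NeZero q₁]
    {χ₁ : DirichletCharacter ℂ q₁} (hp₁ : χ₁.IsPrimitive) (h₁ : χ₁ ^ 2 = 1) (hn₁ : χ₁ ≠ 1)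
    {β : ℝ} (hβ : 1 - η ^ 2 / 2 < β) (hβ1 : β < 1)
    (hpos : ∀ {q₂ q₃ : ℕ} [NeZero q₂] [NeZero q₃] (χ₂ : DirichletCharacter ℂ q₂)
      (ψ : DirichletCharacter ℂ q₃), χ₂ ^ 2 = 1 → χ₂ ≠ 1 → ψ ^ 2 = 1 → ψ ≠ 1 →
      0 ≤ (LFunction χ₁ β * (LFunction χ₂ β * LFunction ψ β)).re) :
    ∃ (Q : ℕ) (C : ℝ), 0 < C ∧ ∀ (q₂ : ℕ) [NeZero q₂] (χ₂ : DirichletCharacter ℂ q₂), Q ≤ q₂ →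
      χ₂.IsPrimitive → χ₂ ^ 2 = 1 → χ₂ ≠ 1 →
      1 ≤ C * (((q₂ : ℝ) ^ (1 + 16 * η)) ^ (1 - β) *
        (LFunction χ₁ 1 * LFunction χ₂ 1 * LFunction (productChar χ₁ χ₂) 1).re) := by
  have hη2 : η ^ 2 < 1 := by nlinarith
  obtain ⟨D, hD, core⟩ := exists_one_le_re_mul_add (θ := 1 - η ^ 2) (β := β) (by linarith)
    (by nlinarith) hβ1
  obtain ⟨B, hB, hsum⟩ := exists_norm_sum_Ioc_tripleConv_le hn₁ hη hη1
  set Z := (∑' n : ℕ, 1 / (n : ℝ) ^ (1 + η)) ^ 2 with hZ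
  obtain ⟨Q, hQ⟩ := exists_forall_mul_rpow_neg_le (D * (8 * B + 4 * Z))
    (c := η ^ 2 / 2) (by positivity)
  refine ⟨max Q (q₁ + 1), 8 / (1 - β), div_pos (by norm_num) (by linarith),
    fun q₂ _ χ₂ hq hp₂ h₂ hn₂ ↦ ?_⟩
  have hq₁ : q₁ < q₂ := (le_max_right _ _).trans hq
  have hq₂ : (1 : ℝ) ≤ q₂ := by exact_mod_cast NeZero.pos q₂
  have hψ := productChar_ne_one hp₁ hp₂ h₂ hq₁.ne
  have hψ2 := productChar_sq h₁ h₂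
  set M := ⌈(q₂ : ℝ) ^ (1 + 8 * η)⌉₊ with hM
  set N := ⌈(q₂ : ℝ) ^ (1 + 16 * η)⌉₊ with hN
  obtain ⟨lam, hlam, elam⟩ := exists_pos_LFunction_one_mul_eq h₁ hn₁ h₂ hn₂
  have hmain := core (tripleConv χ₁ χ₂)
    (fun s ↦ LFunction χ₁ s * (LFunction χ₂ s * LFunction (productChar χ₁ χ₂) s)) B
    (Z * (M : ℝ) ^ (1 + η)) M N (natCeil_rpow_bounds hq₂ (by positivity)).1
    (Nat.ceil_mono (Real.rpow_le_rpow_of_exponent_le hq₂ (by linarith)))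
    (fun n hn ↦ hsum q₂ χ₂ hq₁ hp₂ h₂ n ((Nat.le_ceil _).trans (by exact_mod_cast hn)))
    (sum_Ioc_norm_tripleConv_le hη χ₁ χ₂ M) (fun s hs ↦ LSeriesSummable_tripleConv χ₁ χ₂ hs)
    (fun s hs ↦ (LSeries_tripleConv χ₁ χ₂ hs).symm)
    (fun s _ ↦ ((differentiable_LFunction hn₁).mul
      ((differentiable_LFunction hn₂).mul (differentiable_LFunction hψ))).differentiableAt)
    (fun n ↦ triple_mul_zeta_re_nonneg (changeLevel_mul_changeLevel_natCast χ₁ χ₂) h₁ h₂ n)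
    (triple_mul_zeta_one χ₁ χ₂ _) (hpos χ₂ _ h₂ hn₂ hψ2 hψ)
  rw [mul_assoc] at elam
  rw [mul_assoc, elam, Complex.ofReal_re]
  simp only [elam, Complex.ofReal_re] at hmain
  have herr := mul_le_mul_of_nonneg_left
    (error_terms_le hη hη1 hβ hβ1 hq₂ hM hN hB.le (sq_nonneg _ : 0 ≤ Z)) hD.le
  rw [← mul_assoc] at herr
  have hhalf := herr.trans (hQ q₂ ((le_max_left _ _).trans hq))
  have hNle : (N : ℝ) ^ (1 - β) ≤ 4 * ((q₂ : ℝ) ^ (1 + 16 * η)) ^ (1 - β) := by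
    rw [← Real.rpow_mul (by positivity)]
    exact rpow_natCeil_le hq₂ (by positivity) (by linarith) (by nlinarith)
  have hb : 0 < 1 - β := by linarith
  have h1 : 1 / 2 ≤ lam * ((N : ℝ) ^ (1 - β) / (1 - β)) := by linarith
  have h2 : lam * ((N : ℝ) ^ (1 - β) / (1 - β)) ≤
      lam * (4 * ((q₂ : ℝ) ^ (1 + 16 * η)) ^ (1 - β) / (1 - β)) := by gcongr
  calc (1 : ℝ) ≤ 2 * (lam * (4 * ((q₂ : ℝ) ^ (1 + 16 * η)) ^ (1 - β) / (1 - β))) := by linarith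
    _ = _ := by ring

lemma one_le_rpow_neg_mul {β x X : ℝ} (hβ : β ≤ 1) (hx : 1 ≤ x) (hxX : x ≤ X) :
    1 ≤ x ^ (-β) * X := by
  have hx0 : 0 < x := by linarith
  calc (1 : ℝ) = x ^ (-1 : ℝ) * x := by
        rw [Real.rpow_neg_one, inv_mul_cancel₀ hx0.ne']
    _ ≤ x ^ (-β) * X := by gcongr

end Assembly

/-- For every `0 < ε ≤ 1/2` there are a positive integer `q₁`, a primitive quadratic
character `χ₁` mod `q₁`, a real `β` with `1-ε < β < 1` and a constant `C(ε) > 0` such that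
for every primitive quadratic `χ₂` mod `q₂` and every `x ≥ 1`,
`1 ≤ C (x^(1-β) λ + x^(-β) q₂^(1+ε))`, where
`λ = L(1,χ₁) L(1,χ₂) L(1,χ₁χ₂)` (a real number). -/
theorem key_inequality :
    ∀ ε : ℝ, 0 < ε → ε ≤ 1/2 →
      ∃ (q₁ : ℕ) (_ : NeZero q₁) (χ₁ : DirichletCharacter ℂ q₁) (β C : ℝ),
        χ₁.IsPrimitive ∧ χ₁ ^ 2 = 1 ∧ χ₁ ≠ 1 ∧ 1 - ε < β ∧ β < 1 ∧ 0 < C ∧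
        ∀ (q₂ : ℕ) [NeZero q₂] (χ₂ : DirichletCharacter ℂ q₂),
          χ₂.IsPrimitive → χ₂ ^ 2 = 1 → χ₂ ≠ 1 →
          ∃ lam : ℝ,
            χ₁.LFunction 1 * χ₂.LFunction 1 *
                (changeLevel (dvd_mul_right q₁ q₂) χ₁
                  * changeLevel (dvd_mul_left q₂ q₁) χ₂).LFunction 1 = (lam : ℂ) ∧
            ∀ x : ℝ, 1 ≤ x →
              1 ≤ C * (x ^ (1 - β) * lam + x ^ (-β) * (q₂ : ℝ) ^ (1 + ε)) := by
  intro ε hε hε2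
  obtain ⟨η, rfl⟩ : ∃ η, ε = 16 * η := ⟨ε / 16, by ring⟩
  have hη : 0 < η := by linarith
  have hη1 : η ≤ 1 / 32 := by linarith
  obtain ⟨q₁, hq₁, χ₁, β, hp₁, h₁, hn₁, hβ, hβ1, hpos⟩ :=
    exists_isPrimitive_forall_LFunction_mul_re_nonneg (b := 1 - η ^ 2 / 2) (by nlinarith)
      (by nlinarith)
  obtain ⟨Q, C₁, hC₁, hlarge⟩ := exists_forall_one_le_mul_rpow hη hη1 hp₁ h₁ hn₁ hβ hβ1 hpos
  obtain ⟨C₂, hC₂, hsmall⟩ := exists_forall_one_le_mul_LFunction_one h₁ hn₁ Q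
  refine ⟨q₁, hq₁, χ₁, β, C₁ + C₂ + 1, hp₁, h₁, hn₁, by nlinarith, hβ1, by positivity,
    fun q₂ _ χ₂ hp₂ h₂ hn₂ ↦ ?_⟩
  obtain ⟨lam, hlam, elam⟩ := exists_pos_LFunction_one_mul_eq h₁ hn₁ h₂ hn₂
  refine ⟨lam, elam, fun x hx ↦ ?_⟩
  have hx1 : 1 ≤ x ^ (1 - β) := Real.one_le_rpow hx (by linarith)
  have hmain : 0 ≤ x ^ (1 - β) * lam := by positivity
  have herr : 0 ≤ x ^ (-β) * (q₂ : ℝ) ^ (1 + 16 * η) := by positivity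
  rcases lt_or_ge q₂ Q with hq | hq
  · have h := hsmall q₂ χ₂ hq h₂ hn₂
    rw [elam, Complex.ofReal_re] at h
    calc (1 : ℝ) ≤ C₂ * lam := h
      _ ≤ C₂ * (x ^ (1 - β) * lam) := by
        gcongr
        exact le_mul_of_one_le_left hlam.le hx1
      _ ≤ _ := by
        gcongr <;> linarith
  · rcases le_total ((q₂ : ℝ) ^ (1 + 16 * η)) x with hX | hX
    · have h := hlarge q₂ χ₂ hq hp₂ h₂ hn₂
      rw [elam, Complex.ofReal_re] at h
      calc (1 : ℝ) ≤ C₁ * (((q₂ : ℝ) ^ (1 + 16 * η)) ^ (1 - β) * lam) := h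
        _ ≤ C₁ * (x ^ (1 - β) * lam) := by
          gcongr
        _ ≤ _ := by
          gcongr <;> linarith
    · calc (1 : ℝ) ≤ 1 * (x ^ (-β) * (q₂ : ℝ) ^ (1 + 16 * η)) := by
            rw [one_mul]; exact one_le_rpow_neg_mul hβ1.le hx hX
        _ ≤ _ := by
          gcongr <;> linarith
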